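/- arXiv:1705.04104 — 2 statements merged into one kernel-verified Lean document; each statement's English description precedes it below -/
import Mathlib

section
/- Let A ∈ ℝ_max^{n×n} with λ(A) = 0, g = g(C(A)) ≥ 2 and T_1(A) = DM(g,n); assume C(A) is strongly connected with a unique critical cycle Z_0 of length g up to choice of its first node. Let i be a node of Z_0 and j a node not in Z_0. Then in any interesting walk: (i) there is exactly one occurrence of j between any two consecutive occurrences of i; and (ii) there is exactly one occurrence of j before the first occurrence of i and exactly one occurrence of j after the last occurrence of i. -/
open scoped Classical

noncomputable section

/-- The max-plus semiring carrier: `ℝ ∪ {-∞}`. `max` is the semiring addition `⊕`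
and `+` (with `⊥` absorbing) is the semiring multiplication `⊗`. -/
abbrev Rmax : Type := WithBot ℝ

/-- Square max-plus matrices. -/
abbrev Mat (n : ℕ) : Type := Fin n → Fin n → Rmax

namespace MaxPlus

variable {n : ℕ}

/-- Entrywise max-plus sum of matrices. -/
def oplus (A B : Mat n) : Mat n := fun i j => max (A i j) (B i j)

/-- Max-plus matrix product. -/
def mul (A B : Mat n) : Mat n := fun i j => Finset.univ.sup fun k => A i k + B k j

/-- Max-plus identity matrix. -/
def idm : Mat n := fun i j => if i = j then 0 else ⊥

/-- Max-plus matrix power. -/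
def pow (A : Mat n) : ℕ → Mat n
  | 0 => idm
  | t + 1 => mul A (pow A t)

/-- The arc relation of the digraph `D(A)`. -/
def arc (A : Mat n) (i j : Fin n) : Prop := A i j ≠ ⊥

/-- `W` is a walk of the digraph with arc relation `R` (a nonempty list of nodes,
consecutive nodes joined by arcs). -/
def IsWalk (R : Fin n → Fin n → Prop) (W : List (Fin n)) : Prop := W ≠ [] ∧ W.Chain' R

/-- `W` is a walk from `i` to `j`. -/
def IsWalkFrom (R : Fin n → Fin n → Prop) (W : List (Fin n)) (i j : Fin n) : Prop :=
  IsWalk R W ∧ W.head? = some i ∧ W.getLast? = some j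

/-- The length of a walk: its number of arcs (= number of nodes minus one). -/
def len (W : List (Fin n)) : ℕ := W.length - 1

/-- The weight `p(W)` of a walk: the max-plus product (= sum) of its arc weights. -/
def weight (A : Mat n) (W : List (Fin n)) : Rmax :=
  ((W.zip W.tail).map fun p => A p.1 p.2).sum

/-- A cycle: a closed walk of positive length with no proper closed subwalk. -/
def IsCycle (R : Fin n → Fin n → Prop) (W : List (Fin n)) : Prop :=
  2 ≤ W.length ∧ W.Chain' R ∧ W.head? = W.getLast? ∧ W.dropLast.Nodup

/-- The mean weight of a cycle: its weight divided by its length. -/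
def mean (A : Mat n) (W : List (Fin n)) : Rmax :=
  (weight A W).map fun r => r / (len W : ℝ)

/-- The maximum cycle mean `λ(A)` (equal to `⊥ = -∞` if there are no cycles). -/
def lam (A : Mat n) : Rmax := sSup {m | ∃ W, IsCycle (arc A) W ∧ m = mean A W}

/-- A critical cycle: a cycle of `D(A)` attaining the maximum cycle mean. -/
def IsCritCycle (A : Mat n) (W : List (Fin n)) : Prop :=
  IsCycle (arc A) W ∧ mean A W = lam A

/-- A node of the critical graph `C(A)`. -/
def critNode (A : Mat n) (i : Fin n) : Prop := ∃ W, IsCritCycle A W ∧ i ∈ W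

/-- An arc of the critical graph `C(A)`. -/
def critArc (A : Mat n) (i j : Fin n) : Prop :=
  ∃ W, IsCritCycle A W ∧ (i, j) ∈ W.zip W.tail

/-- Reachability in the digraph with arc relation `R`. -/
def reach (R : Fin n → Fin n → Prop) (i j : Fin n) : Prop := ∃ W, IsWalkFrom R W i j

/-- `i` and `j` lie in the same strongly connected component. -/
def sameSCC (R : Fin n → Fin n → Prop) (i j : Fin n) : Prop := reach R i j ∧ reach R j i

/-- `i` lies on some cycle of the digraph. -/
def onCycle (R : Fin n → Fin n → Prop) (i : Fin n) : Prop := ∃ W, IsCycle R W ∧ i ∈ W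

/-- The girth of the strongly connected component of `i`: the minimal length of a
cycle meeting that component. -/
def girthAt (R : Fin n → Fin n → Prop) (i : Fin n) : ℕ :=
  sInf {t | ∃ W, IsCycle R W ∧ (∃ v ∈ W, sameSCC R i v) ∧ len W = t}

/-- The maximal girth of a (completely reducible) digraph: the maximum of the girths
of its strongly connected components. -/
def maxGirth (R : Fin n → Fin n → Prop) : ℕ :=
  sSup {g | ∃ i, onCycle R i ∧ girthAt R i = g}

/-- The gcd of the cycle lengths in the strongly connected component of `i`
(described as the greatest common divisor of all such cycle lengths). -/
def sccGcd (R : Fin n → Fin n → Prop) (i : Fin n) : ℕ :=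
  sSup {d | ∀ W, IsCycle R W → (∃ v ∈ W, sameSCC R i v) → d ∣ len W}

/-- The cyclicity of a (completely reducible) digraph: the lcm over its strongly
connected components of the gcds of their cycle lengths. -/
def cyclicity (R : Fin n → Fin n → Prop) : ℕ :=
  (Finset.univ.filter fun i => onCycle R i).lcm (sccGcd R)

/-- Kleene star `X^* = I ⊕ X ⊕ ⋯ ⊕ X^{n-1}`. -/
def star (A : Mat n) : Mat n := fun i j => (Finset.range n).sup fun k => pow A k i j

/-- Scalar (max-plus) multiplication of a matrix. -/
def smul (c : Rmax) (A : Mat n) : Mat n := fun i j => c + A i j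

/-- Max-plus negation (inversion) of a scalar. -/
def negB : Rmax → Rmax := WithBot.map Neg.neg

/-- The CSR term `CS^tR[A]`. -/
def csr (A : Mat n) (t : ℕ) : Mat n :=
  if lam A = ⊥ then fun _ _ => ⊥ else
    let M := star (pow (smul (negB (lam A)) A) (cyclicity (critArc A)))
    let C : Mat n := fun i j => if critNode A j then M i j else ⊥
    let S : Mat n := fun i j => if critArc A i j then A i j else ⊥
    let R : Mat n := fun i j => if critNode A i then M i j else ⊥
    mul C (mul (pow S t) R)

/-- The Nachtigall matrix `B_N`: entries with a critical index are set to `-∞`. -/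
def bN (A : Mat n) : Mat n := fun i j => if critNode A i ∨ critNode A j then ⊥ else A i j

/-- The weak CSR threshold `T₁(A) = T₁(A, B_N)`. -/
def T1 (A : Mat n) : ℕ :=
  sInf {T | ∀ t, T ≤ t → pow A t = oplus (csr A t) (pow (bN A) t)}

/-- The Dulmage–Mendelsohn bound `DM(g,n) = g(n-2) + n`. -/
def DM (g N : ℕ) : ℕ := g * (N - 2) + N

/-- The Wielandt bound `Wi(n)`. -/
def Wi (N : ℕ) : ℕ := if N = 1 then 0 else (N - 1) ^ 2 + 1

/-- The matrix `A₁` (0-indexed version of Equation (5) of the paper): it keeps the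
arcs `(i,i+1)` for `1 ≤ i ≤ n-1`, `(n,1)` and `(g,1)` of `A` (in 1-indexed terms). -/
def A1 (A : Mat n) (g : ℕ) : Mat n := fun i j =>
  if j.val = i.val + 1 ∨ (i.val = n - 1 ∧ j.val = 0) ∨ (i.val = g - 1 ∧ j.val = 0)
  then A i j else ⊥

/-- The matrix `B₁`: it keeps the arcs `(i,j)` with `i > g`, `j > g`,
`j ≡ i+1 (mod g)` (in 1-indexed terms). -/
def B1 (A : Mat n) (g : ℕ) : Mat n := fun i j =>
  if g ≤ i.val ∧ g ≤ j.val ∧ j.val % g = (i.val + 1) % g then A i j else ⊥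

/-- The matrix `A₂`: the remaining entries of `A`. -/
def A2 (A : Mat n) (g : ℕ) : Mat n := fun i j =>
  if oplus (A1 A g) (B1 A g) i j ≠ ⊥ then ⊥ else A i j

/-- Strict domination of matrices: `X < Y` entrywise, equality allowed only at `-∞`. -/
def mLt (X Y : Mat n) : Prop := ∀ i j, X i j < Y i j ∨ (X i j = ⊥ ∧ Y i j = ⊥)

/-- The cycle `1 2 ⋯ g 1` (0-indexed: the node list `[0,1,…,g-1,0]`). -/
def stdCyc (N g : ℕ) : List (Fin N) := (List.finRange N).take g ++ (List.finRange N).take 1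

/-- The node list of the walk `(g+1)⋯n(1⋯n)^g` (0-indexed). -/
def wInteresting (N g : ℕ) : List (Fin N) :=
  (List.finRange N).drop g ++ (List.replicate g (List.finRange N)).flatten

/-- The node list of the walk `n(1⋯(n-1))^{n-1}1⋯n` (0-indexed). -/
def wWielandt (N : ℕ) : List (Fin N) :=
  (List.finRange N).drop (N - 1) ++
    (List.replicate (N - 1) ((List.finRange N).take (N - 1))).flatten ++ List.finRange N

/-- Walks from `i` to `j` through a node of `Z₀` whose length is `≡ m (mod γ)`. -/
def ThroughSet (A : Mat n) (Z0 : List (Fin n)) (i j : Fin n) (γ m : ℕ) :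
    Set (List (Fin n)) :=
  {V | IsWalkFrom (arc A) V i j ∧ (∃ v ∈ V, v ∈ Z0) ∧ len V % γ = m % γ}

/-- A twice optimal walk: of minimal length among the walks of maximal weight in
`ThroughSet A Z0 i j γ m`. -/
def TwiceOpt (A : Mat n) (Z0 : List (Fin n)) (i j : Fin n) (γ m : ℕ)
    (W : List (Fin n)) : Prop :=
  W ∈ ThroughSet A Z0 i j γ m ∧
  (∀ V ∈ ThroughSet A Z0 i j γ m, weight A V ≤ weight A W) ∧
  (∀ V ∈ ThroughSet A Z0 i j γ m, weight A V = weight A W → len W ≤ len V)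

/-- An interesting walk: twice optimal (for residue `DM(g,n) - 1` modulo `g`) of
length `DM(g,n) + g - 1`. -/
def Interesting (A : Mat n) (g : ℕ) (Z0 : List (Fin n)) (i j : Fin n)
    (W : List (Fin n)) : Prop :=
  TwiceOpt A Z0 i j g (DM g n - 1) W ∧ len W = DM g n + g - 1

/-- The index of a digraph: the transient of its Boolean adjacency matrix. -/
def Tind (R : Fin n → Fin n → Prop) : ℕ :=
  sInf {T | ∀ t, T ≤ t → ∀ i j : Fin n,
    (∃ W, IsWalkFrom R W i j ∧ len W = t) ↔
      (∃ W, IsWalkFrom R W i j ∧ len W = t + cyclicity R)}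

/-- The transient of row `i` of `A`. -/
def rowTrans (A : Mat n) (i : Fin n) : ℕ :=
  sInf {T | ∀ t, T ≤ t → ∀ j, pow A t i j = csr A t i j}

/-- The transient of column `i` of `A`. -/
def colTrans (A : Mat n) (i : Fin n) : ℕ :=
  sInf {T | ∀ t, T ≤ t → ∀ j, pow A t j i = csr A t j i}

/-- The maximum of the transients of the critical rows and columns of `A`. -/
def critTransMax (A : Mat n) : ℕ :=
  (Finset.univ.filter fun i => critNode A i).sup fun i =>
    max (rowTrans A i) (colTrans A i)

/-- Renumbering of the nodes of `A` by a permutation `σ`. -/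
def renum (σ : Equiv.Perm (Fin n)) (A : Mat n) : Mat n := fun i j => A (σ i) (σ j)

end MaxPlus

namespace MaxPlus

section Walks

variable {n : ℕ} {A : Mat n}

lemma weight_append_cons (A : Mat n) (X : List (Fin n)) (x : Fin n) (Y : List (Fin n)) :
    weight A (X ++ x :: Y) = weight A (X ++ [x]) + weight A (x :: Y) := by
  induction X with
  | nil => simp [weight]
  | cons y X ih =>
    cases X with
    | nil => simp [weight]
    | cons z X =>
      simp only [weight, List.cons_append, List.tail_cons, List.zip_cons_cons, List.map_cons,
        List.sum_cons] at ih ⊢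
      rw [ih, add_assoc]

/-- A list with equal entries at two positions splits around the enclosed closed segment. -/
lemma exists_split_of_getElem?_eq {α : Type*} {W : List α} {s t : ℕ} (hst : s < t)
    (ht : t < W.length) (h : W[s]? = W[t]?) :
    ∃ X x Y Z, W = X ++ x :: (Y ++ x :: Z) ∧ X.length = s ∧ Y.length + s + 1 = t := by
  refine ⟨W.take s, W[s], (W.drop (s + 1)).take (t - s - 1), W.drop (t + 1), ?_, ?_, ?_⟩
  · apply List.ext_getElem?
    grind
  · grind
  · grind

lemma finite_setOf_isCycle (R : Fin n → Fin n → Prop) : {W | IsCycle R W}.Finite := by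
  refine (List.finite_length_le (Fin n) (n + 1)).subset fun W hW => ?_
  have h := hW.2.2.2.length_le_card
  simp only [List.length_dropLast, Fintype.card_fin, Set.mem_ofPred_eq] at h ⊢
  omega

lemma mean_le_lam {W : List (Fin n)} (hW : IsCycle (arc A) W) : mean A W ≤ lam A := by
  have hfin : {m | ∃ W, IsCycle (arc A) W ∧ m = mean A W}.Finite := by
    refine ((finite_setOf_isCycle (arc A)).image (mean A)).subset ?_
    rintro m ⟨W, hW, rfl⟩
    exact ⟨W, hW, rfl⟩
  exact le_csSup hfin.bddAbove ⟨W, hW, rfl⟩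

lemma IsCycle.weight_nonpos (hlam : lam A = 0) {W : List (Fin n)} (hW : IsCycle (arc A) W) :
    weight A W ≤ 0 := by
  have h := mean_le_lam hW
  have hpos : (0 : ℝ) < len W := by
    have := hW.1
    exact_mod_cast (by unfold len; omega : 0 < len W)
  rw [hlam, mean] at h
  cases hw : weight A W with
  | none => exact bot_le
  | some r =>
    change weight A W = (r : WithBot ℝ) at hw
    change (r : WithBot ℝ) ≤ 0
    rw [hw, WithBot.map_coe, ← WithBot.coe_zero, WithBot.coe_le_coe,
      div_le_iff₀ hpos, zero_mul] at h
    exact_mod_cast h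

lemma weight_nonpos_of_closed (hlam : lam A = 0) (W : List (Fin n))
    (hchain : W.IsChain (arc A)) (hclosed : W.head? = W.getLast?) : weight A W ≤ 0 := by
  induction hk : W.length using Nat.strong_induction_on generalizing W with
  | _ k ih =>
  subst hk
  rcases lt_or_ge W.length 2 with hlt | hge
  · match W, hlt with
    | [], _ => simp [weight]
    | [x], _ => simp [weight]
  by_cases hnd : W.dropLast.Nodup
  · exact IsCycle.weight_nonpos hlam ⟨hge, hchain, hclosed, hnd⟩
  rw [List.nodup_iff_getElem?_ne_getElem?] at hnd
  push Not at hnd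
  obtain ⟨s, t, hst, ht, heq⟩ := hnd
  have ht' : t + 1 < W.length := by
    rw [List.length_dropLast] at ht
    omega
  rw [List.getElem?_dropLast, List.getElem?_dropLast, if_pos (by omega), if_pos (by omega)] at heq
  obtain ⟨X, x, Y, Z, rfl, rfl, rfl⟩ := exists_split_of_getElem?_eq hst (by omega) heq
  obtain ⟨h₁, h₂⟩ := List.isChain_split.1 hchain
  obtain ⟨h₃, h₄⟩ := (List.isChain_split (l₁ := x :: Y)).1 h₂
  rw [weight_append_cons A X x (Y ++ x :: Z), ← List.cons_append,
    weight_append_cons A (x :: Y) x Z]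
  have hin : weight A (x :: Y ++ [x]) ≤ 0 := by
    refine ih _ ?_ _ h₃ (by simp [List.getLast?_cons]) rfl
    simp at ht' ⊢
    omega
  have hout : weight A (X ++ x :: Z) ≤ 0 := by
    refine ih _ ?_ _ (List.isChain_split.2 ⟨h₁, h₄⟩) ?_ rfl
    · simp
    · cases X <;> simpa [List.getLast?_cons] using hclosed
  rw [weight_append_cons] at hout
  calc weight A (X ++ [x]) + (weight A (x :: Y ++ [x]) + weight A (x :: Z))
      ≤ weight A (X ++ [x]) + (0 + weight A (x :: Z)) := by gcongr
    _ ≤ 0 := by rwa [zero_add]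

/-- Deleting a closed segment of a walk keeps its endpoints and does not decrease its weight. -/
lemma exists_walk_delete_segment (hlam : lam A = 0) {W : List (Fin n)} {a b : Fin n} {s t : ℕ}
    (hW : IsWalkFrom (arc A) W a b) (hst : s < t) (ht : t < W.length) (h : W[s]? = W[t]?) :
    ∃ V, IsWalkFrom (arc A) V a b ∧ weight A W ≤ weight A V ∧ V.length + (t - s) = W.length ∧
      (∀ m ≤ s, V[m]? = W[m]?) ∧ ∀ m > t, V[m - (t - s)]? = W[m]? := by
  obtain ⟨X, x, Y, Z, rfl, rfl, rfl⟩ := exists_split_of_getElem?_eq hst ht h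
  obtain ⟨⟨-, hchain⟩, hhead, hlast⟩ := hW
  obtain ⟨h₁, h₂⟩ := List.isChain_split.1 hchain
  obtain ⟨h₃, h₄⟩ := (List.isChain_split (l₁ := x :: Y)).1 h₂
  refine ⟨X ++ x :: Z, ⟨⟨by simp, List.isChain_split.2 ⟨h₁, h₄⟩⟩, ?_, ?_⟩, ?_, ?_, ?_, ?_⟩
  · cases X <;> simpa using hhead
  · simpa [List.getLast?_cons] using hlast
  · rw [weight_append_cons A X x Z, weight_append_cons A X x (Y ++ x :: Z), ← List.cons_append,
      weight_append_cons A (x :: Y) x Z]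
    have hin : weight A (x :: Y ++ [x]) ≤ 0 :=
      weight_nonpos_of_closed hlam _ h₃ (by simp [List.getLast?_cons])
    calc weight A (X ++ [x]) + (weight A (x :: Y ++ [x]) + weight A (x :: Z))
        ≤ weight A (X ++ [x]) + (0 + weight A (x :: Z)) := by gcongr
      _ = _ := by rw [zero_add]
  · simp
    omega
  · intro m hm
    rcases hm.lt_or_eq with hm | rfl
    · rw [List.getElem?_append_left hm, List.getElem?_append_left hm]
    · simp
  · intro m hm
    obtain ⟨k, rfl⟩ := Nat.exists_eq_add_of_lt hm
    rw [List.getElem?_append_right (by omega), List.getElem?_append_right (by omega),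
      ← List.cons_append, List.getElem?_append_right (by simp; omega)]
    congr 1
    simp
    omega

/-- Deleting successive closed segments that do not swallow position `p` yields a walk
still visiting the node at position `p`. -/
lemma exists_walk_delete_segments (hlam : lam A = 0) {W : List (Fin n)} {a b : Fin n} {p : ℕ}
    (hW : IsWalkFrom (arc A) W a b) (S : List (ℕ × ℕ))
    (hS : S.Pairwise fun x y => x.2 ≤ y.1)
    (hseg : ∀ x ∈ S, x.1 < x.2 ∧ x.2 < W.length ∧ W[x.1]? = W[x.2]? ∧ ¬ (x.1 < p ∧ p ≤ x.2))
    (c : ℕ) (hc : ∀ x ∈ S, c ≤ x.1) :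
    ∃ V q, IsWalkFrom (arc A) V a b ∧ weight A W ≤ weight A V ∧
      V.length + (S.map fun x => x.2 - x.1).sum = W.length ∧
      (∀ m ≤ c, V[m]? = W[m]?) ∧ V[q]? = W[p]? ∧ (p ≤ c → q = p) ∧ (c < p → c < q) := by
  induction S generalizing c with
  | nil => exact ⟨W, p, hW, le_rfl, by simp, by simp, rfl, fun _ => rfl, id⟩
  | cons x S ih =>
    rw [List.pairwise_cons] at hS
    obtain ⟨hx, hxW, hxeq, hxp⟩ := hseg x (by simp)
    have hcx := hc x (by simp)
    obtain ⟨V, q, hV, hwt, hlen, hpre, hq, hqp, hpq⟩ :=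
      ih hS.2 (fun y hy => hseg y (by simp [hy])) x.2 hS.1
    have hxeq' : V[x.1]? = V[x.2]? := by rw [hpre _ hx.le, hpre _ le_rfl, hxeq]
    have hxV : x.2 < V.length := by
      have := hpre x.2 le_rfl
      grind
    obtain ⟨U, hU, hwt', hlen', hpre', hpost'⟩ := exists_walk_delete_segment hlam hV hx hxV hxeq'
    have hpre'' : ∀ m ≤ c, U[m]? = W[m]? := fun m hm => by
      rw [hpre' m (by omega), hpre m (by omega)]
    have hlenU : U.length + ((x :: S).map fun x => x.2 - x.1).sum = W.length := by
      simp only [List.map_cons, List.sum_cons]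
      omega
    rcases le_or_gt p x.1 with hp | hp
    · refine ⟨U, p, hU, hwt.trans hwt', hlenU, hpre'', ?_, fun _ => rfl, id⟩
      rw [hpre' p hp, ← hq, hqp (by omega)]
    · have hp2 : x.2 < q := hpq (by omega)
      refine ⟨U, q - (x.2 - x.1), hU, hwt.trans hwt', hlenU, hpre'', ?_, ?_, ?_⟩
      · rw [hpost' q hp2, hq]
      · omega
      · omega

end Walks

/-- Any list of `g` integers has a nonempty sublist whose sum is divisible by `g`. -/
lemma exists_sublist_dvd_sum {α : Type*} (f : α → ℕ) {g : ℕ} (hg : 0 < g) (S : List α)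
    (hS : g ≤ S.length) : ∃ T, T.Sublist S ∧ T ≠ [] ∧ g ∣ (T.map f).sum := by
  obtain ⟨u, hu, v, hv, huv, heq⟩ := Finset.exists_ne_map_eq_of_card_lt_of_maps_to
    (s := Finset.range (g + 1)) (t := Finset.range g)
    (f := fun m => ((S.take m).map f).sum % g) (by simp)
    (fun m _ => by simpa using Nat.mod_lt _ hg)
  wlog h : u < v generalizing u v
  · exact this v hv u hu huv.symm heq.symm (by omega)
  rw [Finset.mem_range] at hv
  refine ⟨(S.take v).drop u, (List.drop_sublist _ _).trans (List.take_sublist _ _), ?_, ?_⟩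
  · rw [ne_eq, List.drop_eq_nil_iff, List.length_take]
    omega
  · have hsplit : ((S.take v).map f).sum
        = ((S.take u).map f).sum + (((S.take v).drop u).map f).sum := by
      rw [← List.sum_append, ← List.map_append]
      conv_lhs => rw [← List.take_append_drop u (S.take v), List.take_take, min_eq_left h.le]
    have hmod : ((S.take u).map f).sum ≡ ((S.take v).map f).sum [MOD g] := heq
    have := (Nat.modEq_iff_dvd' (by omega)).1 hmod
    rwa [hsplit, Nat.add_sub_cancel_left] at this

/-- The gaps between consecutive elements of a finite set of naturals. -/
lemma exists_gaps (F : Finset ℕ) :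
    ∃ S : List (ℕ × ℕ), S.length = F.card - 1 ∧ S.Pairwise (fun x y => x.2 ≤ y.1) ∧
      ∀ x ∈ S, x.1 ∈ F ∧ x.2 ∈ F ∧ x.1 < x.2 := by
  induction F using Finset.induction_on_min with
  | empty => exact ⟨[], by simp⟩
  | insert m F hm ih =>
    have hmF : m ∉ F := fun h => (hm m h).false
    rcases F.eq_empty_or_nonempty with rfl | hF
    · exact ⟨[], by simp⟩
    obtain ⟨S, hcard, hS, hmem⟩ := ih
    have := hF.card_pos
    refine ⟨(m, F.min' hF) :: S, ?_, ?_, ?_⟩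
    · rw [Finset.card_insert_of_notMem hmF, List.length_cons, hcard]
      omega
    · exact List.pairwise_cons.2 ⟨fun x hx => F.min'_le _ (hmem x hx).1, hS⟩
    · intro x hx
      rcases List.mem_cons.1 hx with rfl | hx
      · exact ⟨by simp, by simp [F.min'_mem hF], hm _ (F.min'_mem hF)⟩
      · obtain ⟨h₁, h₂, h₃⟩ := hmem x hx
        exact ⟨by simp [h₁], by simp [h₂], h₃⟩

/-- If `J` meets every gap of `I`, including the two unbounded ones, and has at most one more
element than `I`, then each `p ∈ I` is preceded by exactly one more element of `J` than of `I`. -/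
lemma card_filter_of_interleaved {I J : Finset ℕ}
    (hleft : ∀ p ∈ I, ∃ q ∈ J, q < p) (hright : ∀ p ∈ I, ∃ q ∈ J, p < q)
    (hmid : ∀ p ∈ I, ∀ p' ∈ I, p < p' → ∃ q ∈ J, p < q ∧ q < p')
    (hcard : J.card ≤ I.card + 1) {p : ℕ} (hp : p ∈ I) :
    (J.filter (· < p)).card = (I.filter (· < p)).card + 1 := by
  have hlt : (I.filter (· < p)).card + 1 ≤ (J.filter (· < p)).card := by
    obtain ⟨q₀, hq₀, hq₀p⟩ := hleft p hp
    have hne : (J.filter (· < p)).Nonempty := ⟨q₀, by simp [hq₀, hq₀p]⟩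
    have h := Finset.card_le_of_interleaved (s := insert p (I.filter (· < p)))
      (t := (J.filter (· < p)).erase ((J.filter (· < p)).min' hne)) ?_
    · rw [Finset.card_insert_of_notMem (by simp), Finset.card_erase_of_mem (Finset.min'_mem _ _)]
        at h
      have := hne.card_pos
      omega
    · intro x hx y hy hxy _
      have hxI : x ∈ I := by
        rcases Finset.mem_insert.1 hx with rfl | hx
        exacts [hp, (Finset.mem_filter.1 hx).1]
      have hyI : y ∈ I ∧ y ≤ p := by
        rcases Finset.mem_insert.1 hy with rfl | hy
        exacts [⟨hp, le_rfl⟩, ⟨(Finset.mem_filter.1 hy).1, (Finset.mem_filter.1 hy).2.le⟩]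
      obtain ⟨q, hq, hxq, hqy⟩ := hmid x hxI y hyI.1 hxy
      obtain ⟨r, hr, hrx⟩ := hleft x hxI
      have hmin := (J.filter (· < p)).min'_le r
        (Finset.mem_filter.2 ⟨hr, by omega⟩)
      exact ⟨q, Finset.mem_erase.2 ⟨by omega, Finset.mem_filter.2 ⟨hq, by omega⟩⟩, hxq, hqy⟩
  have hgt : (I.filter (p < ·)).card + 1 ≤ (J.filter (p < ·)).card := by
    obtain ⟨q₀, hq₀, hq₀p⟩ := hright p hp
    have hne : (J.filter (p < ·)).Nonempty := ⟨q₀, by simp [hq₀, hq₀p]⟩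
    have h := Finset.card_le_of_interleaved (s := insert p (I.filter (p < ·)))
      (t := (J.filter (p < ·)).erase ((J.filter (p < ·)).max' hne)) ?_
    · rw [Finset.card_insert_of_notMem (by simp), Finset.card_erase_of_mem (Finset.max'_mem _ _)]
        at h
      have := hne.card_pos
      omega
    · intro x hx y hy hxy _
      have hyI : y ∈ I := by
        rcases Finset.mem_insert.1 hy with rfl | hy
        exacts [hp, (Finset.mem_filter.1 hy).1]
      have hxI : x ∈ I ∧ p ≤ x := by
        rcases Finset.mem_insert.1 hx with rfl | hx
        exacts [⟨hp, le_rfl⟩, ⟨(Finset.mem_filter.1 hx).1, (Finset.mem_filter.1 hx).2.le⟩]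
      obtain ⟨q, hq, hxq, hqy⟩ := hmid x hxI.1 y hyI hxy
      obtain ⟨r, hr, hyr⟩ := hright y hyI
      have hmax := (J.filter (p < ·)).le_max' r
        (Finset.mem_filter.2 ⟨hr, by omega⟩)
      exact ⟨q, Finset.mem_erase.2 ⟨by omega, Finset.mem_filter.2 ⟨hq, by omega⟩⟩, hxq, hqy⟩
  have hI : I.card = (I.filter (· < p)).card + (I.filter (p < ·)).card + 1 := by
    rw [← Finset.card_filter_add_card_filter_not (s := I) (· < p), add_assoc]
    congr 1
    rw [← Finset.card_insert_of_notMem (a := p) (by simp)]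
    congr 1
    ext q
    simp only [Finset.mem_filter, Finset.mem_insert, not_lt]
    constructor
    · rintro ⟨hq, hpq⟩
      rcases hpq.eq_or_lt with rfl | h
      exacts [Or.inl rfl, Or.inr ⟨hq, h⟩]
    · rintro (rfl | ⟨hq, hpq⟩)
      exacts [⟨hp, le_rfl⟩, ⟨hq, hpq.le⟩]
  have hJ : (J.filter (· < p)).card + (J.filter (p < ·)).card ≤ J.card := by
    rw [← Finset.card_union_of_disjoint]
    · exact Finset.card_le_card (Finset.union_subset (Finset.filter_subset _ _)
        (Finset.filter_subset _ _))
    · exact Finset.disjoint_filter.2 fun q _ h => by omega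
  omega

/-- The positions at which `v` occurs in a list. -/
def positions {α : Type*} (W : List α) (v : α) : Finset ℕ :=
  (Finset.range W.length).filter fun m => W[m]? = some v

lemma mem_positions {α : Type*} {W : List α} {v : α} {m : ℕ} :
    m ∈ positions W v ↔ W[m]? = some v := by
  simp only [positions, Finset.mem_filter, Finset.mem_range, and_iff_right_iff_imp]
  intro h
  exact (List.getElem?_eq_some_iff.1 h).1

lemma count_take_eq_card {α : Type*} [DecidableEq α] (W : List α) (v : α) (b : ℕ) :
    (W.take b).count v = ((positions W v).filter (· < b)).card := by
  induction b with
  | zero => simp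
  | succ b ih =>
    rw [List.take_add_one, List.count_append, ih]
    by_cases h : W[b]? = some v
    · have : (positions W v).filter (· < b + 1) = insert b ((positions W v).filter (· < b)) := by
        ext m
        simp only [Finset.mem_filter, Finset.mem_insert, mem_positions, Nat.lt_succ_iff_lt_or_eq]
        grind
      rw [this, Finset.card_insert_of_notMem (by simp), h]
      simp
    · have : (positions W v).filter (· < b + 1) = (positions W v).filter (· < b) := by
        ext m
        simp only [Finset.mem_filter, mem_positions, Nat.lt_succ_iff_lt_or_eq]
        grind
      rw [this]
      cases hb : W[b]? with
      | none => simp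
      | some w =>
        have : w ≠ v := fun hw => h (by rw [hb, hw])
        simp [this]

lemma count_eq_card_positions {α : Type*} [DecidableEq α] (W : List α) (v : α) :
    W.count v = (positions W v).card := by
  have h := count_take_eq_card W v W.length
  rwa [List.take_length, Finset.filter_true_of_mem] at h
  intro m hm
  exact (List.getElem?_eq_some_iff.1 (mem_positions.1 hm)).1

section TwiceOptimal

variable {n : ℕ} {A : Mat n} {g r : ℕ} {Z0 W : List (Fin n)} {a b z v : Fin n}

/-- A twice optimal walk has fewer than `g` successive closed segments avoiding a given visit
to `Z0`. -/
lemma TwiceOpt.length_segments_lt (hlam : lam A = 0) (hg : 0 < g)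
    (hW : TwiceOpt A Z0 a b g r W) {p : ℕ} (hp : W[p]? = some z) (hz : z ∈ Z0)
    (S : List (ℕ × ℕ)) (hS : S.Pairwise fun x y => x.2 ≤ y.1)
    (hseg : ∀ x ∈ S, x.1 < x.2 ∧ x.2 < W.length ∧ W[x.1]? = W[x.2]? ∧ ¬ (x.1 < p ∧ p ≤ x.2)) :
    S.length < g := by
  by_contra! hlen
  obtain ⟨⟨hWfrom, -, hWmod⟩, hmax, hmin⟩ := hW
  obtain ⟨T, hTS, hT, hdvd⟩ := exists_sublist_dvd_sum (fun x : ℕ × ℕ => x.2 - x.1) hg S hlen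
  have hseg' := fun x hx => hseg x (hTS.subset hx)
  obtain ⟨V, q, hV, hwt, hVlen, -, hq, -, -⟩ :=
    exists_walk_delete_segments hlam hWfrom T (hS.sublist hTS) hseg' 0 (by simp)
  have hVpos : 0 < V.length := List.length_pos_iff.2 hV.1.1
  have hsum : 0 < (T.map fun x => x.2 - x.1).sum := by
    obtain ⟨x, T, rfl⟩ := List.exists_cons_of_ne_nil hT
    have := (hseg' x (by simp)).1
    simp only [List.map_cons, List.sum_cons]
    omega
  have hlenVW : len V + (T.map fun x => x.2 - x.1).sum = len W := by
    unfold len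
    omega
  have hmem : V ∈ ThroughSet A Z0 a b g r := by
    refine ⟨hV, ⟨z, List.mem_of_getElem? (hq.trans hp), hz⟩, ?_⟩
    obtain ⟨k, hk⟩ := hdvd
    rw [← hWmod, ← hlenVW, hk, Nat.add_mul_mod_self_left]
  have := hmin V hmem (le_antisymm (hmax V hmem) hwt)
  omega

/-- The closed segments at `v` before `p`, the one at `z` from `p` to `p'`, and those at `v`
after `p'` are together fewer than `g`. -/
lemma TwiceOpt.card_gaps_lt (hlam : lam A = 0) (hg : 0 < g)
    (hW : TwiceOpt A Z0 a b g r W) (hz : z ∈ Z0) {p p' : ℕ} (hpp : p ≤ p')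
    (hp : W[p]? = some z) (hp' : W[p']? = some z) (F G : Finset ℕ)
    (hF : ∀ m ∈ F, W[m]? = some v ∧ m < p) (hG : ∀ m ∈ G, W[m]? = some v ∧ p' ≤ m) :
    (F.card - 1) + (G.card - 1) + min (p' - p) 1 < g := by
  obtain ⟨S, hS, hSpw, hSmem⟩ := exists_gaps F
  obtain ⟨T, hT, hTpw, hTmem⟩ := exists_gaps G
  obtain ⟨M, hM, hMpw, hMmem⟩ : ∃ M : List (ℕ × ℕ), M.length = min (p' - p) 1 ∧
      M.Pairwise (fun x y => x.2 ≤ y.1) ∧ ∀ x ∈ M, x = (p, p') ∧ p < p' := by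
    rcases hpp.eq_or_lt with rfl | h
    · exact ⟨[], by simp⟩
    · exact ⟨[(p, p')], by simp; omega, by simp, by simpa using h⟩
  have h := hW.length_segments_lt hlam hg hp hz (S ++ M ++ T) ?_ ?_
  · simp only [List.length_append] at h
    omega
  · rw [List.pairwise_append, List.pairwise_append]
    refine ⟨⟨hSpw, hMpw, ?_⟩, hTpw, ?_⟩
    · intro x hx y hy
      have h₁ := hF _ (hSmem x hx).2.1
      rw [(hMmem y hy).1]
      exact h₁.2.le
    · intro x hx y hy
      have h₁ := hG _ (hTmem y hy).1
      rcases List.mem_append.1 hx with hx | hx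
      · have h₂ := hF _ (hSmem x hx).2.1
        omega
      · rw [(hMmem x hx).1]
        exact h₁.2
  · have hclosed : ∀ (s t : ℕ) (u : Fin n), W[s]? = some u → W[t]? = some u →
        t < W.length ∧ W[s]? = W[t]? :=
      fun s t u hs ht => ⟨(List.getElem?_eq_some_iff.1 ht).1, hs.trans ht.symm⟩
    intro x hx
    rcases List.mem_append.1 hx with hx | hx
    · rcases List.mem_append.1 hx with hx | hx
      · obtain ⟨h₁, h₂, h₃⟩ := hSmem x hx
        have h₄ := hF _ h₂
        obtain ⟨h₅, h₆⟩ := hclosed _ _ _ (hF _ h₁).1 h₄.1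
        exact ⟨h₃, h₅, h₆, by omega⟩
      · obtain ⟨rfl, h⟩ := hMmem x hx
        obtain ⟨h₅, h₆⟩ := hclosed _ _ _ hp hp'
        exact ⟨h, h₅, h₆, by simp⟩
    · obtain ⟨h₁, h₂, h₃⟩ := hTmem x hx
      have h₄ := hG _ h₁
      obtain ⟨h₅, h₆⟩ := hclosed _ _ _ h₄.1 (hG _ h₂).1
      exact ⟨h₃, h₅, h₆, by omega⟩

lemma TwiceOpt.count_le_of_mem (hlam : lam A = 0) (hg : 0 < g)
    (hW : TwiceOpt A Z0 a b g r W) (hz : z ∈ Z0) : W.count z ≤ g := by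
  rw [count_eq_card_positions]
  rcases (positions W z).eq_empty_or_nonempty with h | hne
  · simp [h]
  have hp := mem_positions.1 ((positions W z).min'_mem hne)
  have h := hW.card_gaps_lt hlam hg hz le_rfl hp hp ∅ (positions W z) (v := z) (by simp)
    fun m hm => ⟨mem_positions.1 hm, Finset.min'_le _ _ hm⟩
  simp only [Finset.card_empty] at h
  omega

lemma TwiceOpt.count_le (hlam : lam A = 0) (hg : 0 < g)
    (hW : TwiceOpt A Z0 a b g r W) (v : Fin n) : W.count v ≤ g + 1 := by
  obtain ⟨z, hzW, hz⟩ := hW.1.2.1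
  obtain ⟨p, hp⟩ := List.mem_iff_getElem?.1 hzW
  have h := hW.card_gaps_lt hlam hg hz le_rfl hp hp ((positions W v).filter (· < p))
    ((positions W v).filter (¬ · < p)) (v := v)
    (fun m hm => by simpa [mem_positions] using hm) (fun m hm => by simpa [mem_positions] using hm)
  have hc := Finset.card_filter_add_card_filter_not (s := positions W v) (· < p)
  rw [count_eq_card_positions]
  omega

lemma sum_count_eq_length (W : List (Fin n)) : ∑ v, W.count v = W.length := by
  simpa using Multiset.sum_count_eq_card (s := Finset.univ) (m := (W : Multiset (Fin n)))
    (fun _ _ => Finset.mem_univ _)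

/-- An interesting walk attains the occurrence bounds of twice optimal walks at every node. -/
lemma Interesting.count_eq (hlam : lam A = 0) (hg : 2 ≤ g) (hZ0 : IsCycle (arc A) Z0)
    (hZ0len : len Z0 = g) (hW : Interesting A g Z0 a b W) (v : Fin n) :
    W.count v = if v ∈ Z0 then g else g + 1 := by
  obtain ⟨hopt, hlen⟩ := hW
  have hle : ∀ u, W.count u ≤ if u ∈ Z0 then g else g + 1 := by
    intro u
    split_ifs with hu
    · exact hopt.count_le_of_mem hlam (by omega) hu
    · exact hopt.count_le hlam (by omega) u
  refine (hle v).antisymm (le_of_not_gt fun hlt => ?_)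
  have hsum := Finset.sum_lt_sum (s := Finset.univ) (fun u _ => hle u) ⟨v, Finset.mem_univ v, hlt⟩
  rw [sum_count_eq_length] at hsum
  have hcardZ : g ≤ Z0.toFinset.card := by
    have h₁ : Z0.dropLast.toFinset ⊆ Z0.toFinset := fun x hx => by
      rw [List.mem_toFinset] at hx ⊢
      exact List.dropLast_subset _ hx
    have h₂ := Finset.card_le_card h₁
    rw [List.toFinset_card_of_nodup hZ0.2.2.2, List.length_dropLast] at h₂
    exact hZ0len ▸ h₂
  have hcardn : Z0.toFinset.card ≤ n := by simpa using Z0.toFinset.card_le_univ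
  have htotal : (∑ u : Fin n, if u ∈ Z0 then g else g + 1) + Z0.toFinset.card = n * (g + 1) := by
    have hind : Z0.toFinset.card = ∑ u : Fin n, if u ∈ Z0 then 1 else 0 := by
      rw [← Finset.card_filter]
      congr 1
      ext u
      simp
    rw [hind, ← Finset.sum_add_distrib, Finset.sum_congr rfl (g := fun _ => g + 1)]
    · simp
    · intro u _
      split_ifs <;> rfl
  have hWlen : W.length = g * (n - 2) + n + g := by
    unfold len DM at hlen
    omega
  obtain ⟨k, rfl⟩ := Nat.exists_eq_add_of_le (show 2 ≤ n by omega)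
  rw [Nat.add_sub_cancel_left] at hWlen
  nlinarith

end TwiceOptimal

lemma takeWhile_append_cons_self {α : Type*} [DecidableEq α] {i : α} {X Y : List α} (h : i ∉ X) :
    (X ++ i :: Y).takeWhile (fun v => v != i) = X := by
  rw [List.takeWhile_append_of_pos, List.takeWhile_cons_of_neg (by simp), List.append_nil]
  intro x hx
  simpa using fun hxi : x = i => h (hxi ▸ hx)

/-- Lemma 4.14 (Interlacing): let `i` be a node of `Z₀` and `j` a node not in `Z₀`.
In any interesting walk: (i) there is exactly one occurrence of `j` between two
consecutive occurrences of `i`; (ii) there is exactly one occurrence of `j` before the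
first occurrence of `i` and exactly one after the last occurrence of `i`. -/
theorem interesting_walk_interlacing {n : ℕ} (A : Mat n) (g : ℕ)
    (hgdef : g = maxGirth (critArc A)) (hg : 2 ≤ g) (hlam : lam A = 0)
    (hT : T1 A = DM g n)
    (Z0 : List (Fin n)) (hZ0 : IsCritCycle A Z0) (hZ0len : len Z0 = g)
    (hSC : ∀ i' j', critNode A i' → critNode A j' → reach (critArc A) i' j')
    (huniq : ∀ Z, IsCritCycle A Z → len Z = g → Z.dropLast ~r Z0.dropLast)
    (i j : Fin n) (hi : i ∈ Z0) (hj : j ∉ Z0) :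
    ∀ a b W0, Interesting A g Z0 a b W0 →
      -- (i): between two consecutive occurrences of `i` there is exactly one
      -- occurrence of `j`
      (∀ k1 k2 : ℕ, k1 < k2 → ∀ hk2 : k2 < W0.length,
        W0.getD k1 i = i → W0.getD k2 i = i →
        (∀ m, k1 < m → m < k2 → W0.getD m i ≠ i) →
        ((W0.take k2).drop (k1 + 1)).count j = 1) ∧
      -- (ii): exactly one occurrence of `j` before the first occurrence of `i` …
      (W0.takeWhile (fun v => v != i)).count j = 1 ∧
      -- … and exactly one after the last occurrence of `i`
      (W0.reverse.takeWhile (fun v => v != i)).count j = 1 := by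
  intro a b W hW
  have hij : i ≠ j := fun h => hj (h ▸ hi)
  set I := positions W i with hIdef
  set J := positions W j with hJdef
  have hIcard : I.card = g := by
    rw [hIdef, ← count_eq_card_positions, hW.count_eq hlam hg hZ0.1 hZ0len, if_pos hi]
  have hJcard : J.card = g + 1 := by
    rw [hJdef, ← count_eq_card_positions, hW.count_eq hlam hg hZ0.1 hZ0len, if_neg hj]
  have hdisj : ∀ p ∈ I, p ∉ J := fun p hpI hpJ => hij <| Option.some.inj <|
    (mem_positions.1 hpI).symm.trans (mem_positions.1 hpJ)
  have hgaps : ∀ p ∈ I, ∀ p' ∈ I, p ≤ p' → ∀ F ⊆ J, ∀ G ⊆ J, (∀ m ∈ F, m < p) →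
      (∀ m ∈ G, p' ≤ m) → (F.card - 1) + (G.card - 1) + min (p' - p) 1 < g :=
    fun p hp p' hp' hpp F hF G hG hFp hGp =>
      hW.1.card_gaps_lt hlam (by omega) hi hpp (mem_positions.1 hp) (mem_positions.1 hp') F G
        (fun m hm => ⟨mem_positions.1 (hF hm), hFp m hm⟩)
        (fun m hm => ⟨mem_positions.1 (hG hm), hGp m hm⟩)
  have hleft : ∀ p ∈ I, ∃ q ∈ J, q < p := by
    intro p hp
    by_contra! h
    have := hgaps p hp p hp le_rfl ∅ (by simp) J le_rfl (by simp) h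
    omega
  have hright : ∀ p ∈ I, ∃ q ∈ J, p < q := by
    intro p hp
    by_contra! h
    have := hgaps p hp p hp le_rfl J le_rfl ∅ (by simp)
      (fun m hm => (h m hm).lt_of_ne fun hmp => hdisj p hp (hmp ▸ hm)) (by simp)
    omega
  have hmid : ∀ p ∈ I, ∀ p' ∈ I, p < p' → ∃ q ∈ J, p < q ∧ q < p' := by
    intro p hp p' hp' hpp
    by_contra! h
    have hgap := hgaps p hp p' hp' hpp.le (J.filter (· < p)) (Finset.filter_subset _ _)
      (J.filter (¬ · < p)) (Finset.filter_subset _ _) (by simp) fun m hm => by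
        obtain ⟨hmJ, hm⟩ := Finset.mem_filter.1 hm
        exact h m hmJ ((not_lt.1 hm).lt_of_ne fun hpm => hdisj p hp (hpm ▸ hmJ))
    have hcard := Finset.card_filter_add_card_filter_not (s := J) (· < p)
    obtain ⟨q, hq, hqp⟩ := hleft p hp
    obtain ⟨q', hq', hpq'⟩ := hright p hp
    have h₁ : 0 < (J.filter (· < p)).card :=
      Finset.card_pos.2 ⟨q, Finset.mem_filter.2 ⟨hq, hqp⟩⟩
    have h₂ : 0 < (J.filter (¬ · < p)).card :=
      Finset.card_pos.2 ⟨q', Finset.mem_filter.2 ⟨hq', by omega⟩⟩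
    omega
  have hcount := fun {p} (hp : p ∈ I) =>
    card_filter_of_interleaved hleft hright hmid (by omega) hp
  have htake : ∀ p ∈ I, (W.take (p + 1)).count j = (J.filter (· < p)).card := by
    intro p hp
    rw [count_take_eq_card]
    congr 1
    refine Finset.filter_congr fun q hq => ?_
    have : q ≠ p := fun hqp => hdisj p hp (hqp ▸ hq)
    omega
  have hsplit : ∀ p ∈ I, W = W.take p ++ i :: W.drop (p + 1) := by
    intro p hp
    obtain ⟨hlt, heq⟩ := List.getElem?_eq_some_iff.1 (mem_positions.1 hp)
    rw [← heq, ← List.drop_eq_getElem_cons, List.take_append_drop]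
  have hIne : I.Nonempty := Finset.card_pos.1 (by omega)
  refine ⟨?_, ?_, ?_⟩
  · intro k₁ k₂ hk hk₂ h₁ h₂ hbetween
    have hmem : ∀ m < W.length, W.getD m i = i → m ∈ I := fun m hm h => by
      rw [List.getD_eq_getElem _ _ hm] at h
      exact mem_positions.2 (List.getElem?_eq_some_iff.2 ⟨hm, h⟩)
    have hk₁I := hmem k₁ (by omega) h₁
    have hk₂I := hmem k₂ hk₂ h₂
    have hI : I.filter (· < k₂) = insert k₁ (I.filter (· < k₁)) := by
      ext m
      simp only [Finset.mem_filter, Finset.mem_insert]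
      constructor
      · rintro ⟨hm, hmk⟩
        by_contra! hcon
        have : ¬ m < k₁ := fun h => absurd (hcon.2 hm) (not_le.2 h)
        refine hbetween m (by omega) hmk ?_
        rw [List.getD_eq_getElem?_getD, mem_positions.1 hm, Option.getD_some]
      · rintro (rfl | ⟨hm, hmk⟩)
        exacts [⟨hk₁I, hk⟩, ⟨hm, hmk.trans hk⟩]
    have hIcard₂ : (I.filter (· < k₂)).card = (I.filter (· < k₁)).card + 1 := by
      rw [hI, Finset.card_insert_of_notMem (by simp)]
    have hadd : (W.take k₂).count j
        = (W.take (k₁ + 1)).count j + ((W.take k₂).drop (k₁ + 1)).count j := by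
      conv_lhs => rw [← List.take_append_drop (k₁ + 1) (W.take k₂), List.take_take,
        min_eq_left (Nat.succ_le_of_lt hk), List.count_append]
    rw [htake k₁ hk₁I, count_take_eq_card, hcount hk₁I, hcount hk₂I, hIcard₂] at hadd
    omega
  · have hp := I.min'_mem hIne
    have hempty : I.filter (· < I.min' hIne) = ∅ :=
      Finset.filter_eq_empty_iff.2 fun m hm => not_lt.2 (I.min'_le m hm)
    have hnot : i ∉ W.take (I.min' hIne) := by
      rw [← List.count_eq_zero, count_take_eq_card, ← hIdef, hempty, Finset.card_empty]
    rw [hsplit _ hp, takeWhile_append_cons_self hnot, count_take_eq_card, ← hJdef, hcount hp,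
      hempty, Finset.card_empty]
  · have hp := I.max'_mem hIne
    have hempty : I.filter (I.max' hIne < ·) = ∅ :=
      Finset.filter_eq_empty_iff.2 fun m hm => not_lt.2 (I.le_max' m hm)
    have hfull : I.filter (· < I.max' hIne + 1) = I :=
      Finset.filter_true_of_mem fun m hm => Nat.lt_succ_of_le (I.le_max' m hm)
    have hcountI := congrArg (List.count i) (List.take_append_drop (I.max' hIne + 1) W)
    have hcountJ := congrArg (List.count j) (List.take_append_drop (I.max' hIne + 1) W)
    rw [List.count_append, count_take_eq_card, count_eq_card_positions W, ← hIdef, hfull]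
      at hcountI
    rw [List.count_append, htake _ hp, count_eq_card_positions W, ← hJdef] at hcountJ
    have hnot : i ∉ (W.drop (I.max' hIne + 1)).reverse := by
      rw [List.mem_reverse, ← List.count_eq_zero]
      omega
    have hrev : W.reverse = (W.drop (I.max' hIne + 1)).reverse ++
        i :: (W.take (I.max' hIne)).reverse := by
      conv_lhs => rw [hsplit _ hp]
      simp
    rw [hrev, takeWhile_append_cons_self hnot, List.count_reverse]
    have hIlt : I.filter (· < I.max' hIne) = I.erase (I.max' hIne) := by
      ext m
      rw [Finset.mem_filter, Finset.mem_erase, and_comm]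
      exact and_congr_left fun hm =>
        ⟨fun h => h.ne, fun h => (I.le_max' m hm).lt_of_ne h⟩
    have hlt := hcount hp
    rw [hIlt, Finset.card_erase_of_mem hp] at hlt
    omega


end MaxPlus
end
end

section
/- Let A ∈ ℝ_max^{n×n} with λ(A) = 0, g = g(C(A)) ≥ 2 and T_1(A) = DM(g,n); assume C(A) is strongly connected with a unique critical cycle Z_0 of length g up to choice of its first node. Then any interesting walk W_0 can be written as a concatenation W_0 = P Q P_1 V, where P and P_1 each contain every node not in Z_0 exactly once and contain only such nodes, Q contains every node of Z_0 exactly once and contains only such nodes, and V is a walk starting with a node of Z_0. -/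
open scoped Classical

noncomputable section

namespace MaxPlus

/-- The visits of the node `v` by the sequence `w` at times in `S`. -/
def visits {α : Type*} (w : ℕ → α) (S : Finset ℕ) (v : α) : Finset ℕ := S.filter fun i => w i = v

lemma mem_visits {α : Type*} {w : ℕ → α} {S : Finset ℕ} {v : α} {i : ℕ} :
    i ∈ visits w S v ↔ i ∈ S ∧ w i = v := by
  simp [visits]

/-- Among the times of `[0, L]`, no two disjoint closed stretches whose total length is a positive
multiple of `g` can be cut out of `w` while keeping a visit to `Z`. -/
def Irreducible {α : Type*} (w : ℕ → α) (g L : ℕ) (Z : Finset α) : Prop :=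
  ∀ s s' u u' y : ℕ, s ≤ s' → s' ≤ u → u ≤ u' → u' ≤ L → w s = w s' → w u = w u' →
    (s < s' ∨ u < u') → ((s' : ZMod g) - s + (u' - u) = 0) → w y ∈ Z →
    (y ≤ s ∨ (s' ≤ y ∧ y ≤ u) ∨ (u' ≤ y ∧ y ≤ L)) → False

section Irreducible

variable {α : Type*} {w : ℕ → α} {g L : ℕ} {Z : Finset α}

/-- Cutting out a single closed stretch. -/
lemma Irreducible.single (h : Irreducible w g L Z) {s s' y : ℕ} (hs : s < s') (hs' : s' ≤ L)
    (hw : w s = w s') (hc : (s' : ZMod g) = s) (hy : w y ∈ Z) (hyL : y ≤ L)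
    (hys : y ≤ s ∨ s' ≤ y) : False :=
  h s s' L L y hs.le hs' le_rfl le_rfl hw rfl (Or.inl hs) (by rw [hc]; ring) hy
    (hys.imp_right fun h => Or.inl ⟨h, hyL⟩)

lemma Irreducible.injOn_right (h : Irreducible w g L Z) {t : ℕ} (ht : t ≤ L) (htZ : w t ∈ Z)
    (v : α) : Set.InjOn (fun i : ℕ => (i : ZMod g)) (visits w (Finset.Icc t L) v) := by
  intro i hi j hj hij
  simp only [Finset.mem_coe, mem_visits, Finset.mem_Icc] at hi hj
  rcases lt_trichotomy i j with hlt | heq | hlt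
  · exact (h.single hlt hj.1.2 (hi.2.trans hj.2.symm) hij.symm htZ ht (Or.inl hi.1.1)).elim
  · exact heq
  · exact (h.single hlt hi.1.2 (hj.2.trans hi.2.symm) hij htZ ht (Or.inl hj.1.1)).elim

lemma Irreducible.injOn_left (h : Irreducible w g L Z) {t : ℕ} (ht : t ≤ L) (htZ : w t ∈ Z)
    (v : α) : Set.InjOn (fun i : ℕ => (i : ZMod g)) (visits w (Finset.range t) v) := by
  intro i hi j hj hij
  simp only [Finset.mem_coe, mem_visits, Finset.mem_range] at hi hj
  rcases lt_trichotomy i j with hlt | heq | hlt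
  · exact (h.single hlt (by omega) (hi.2.trans hj.2.symm) hij.symm htZ ht (by omega)).elim
  · exact heq
  · exact (h.single hlt (by omega) (hj.2.trans hi.2.symm) hij htZ ht (by omega)).elim

variable [NeZero g]

lemma card_le_of_injOn_cast {S : Finset ℕ} {f : ℕ → ZMod g} (h : Set.InjOn f S) :
    S.card ≤ g := by
  have := Finset.card_le_card_of_injOn (t := Finset.univ) f (by simp) h
  simpa [ZMod.card] using this

lemma Irreducible.card_right_le (h : Irreducible w g L Z) {t : ℕ} (ht : t ≤ L) (htZ : w t ∈ Z)
    (v : α) : (visits w (Finset.Icc t L) v).card ≤ g :=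
  card_le_of_injOn_cast (h.injOn_right ht htZ v)

/-- A node visited `g` times from time `t` on is visited in each residue class. -/
lemma Irreducible.exists_visit (h : Irreducible w g L Z) {t : ℕ} (ht : t ≤ L) (htZ : w t ∈ Z)
    {v : α} (hv : (visits w (Finset.Icc t L) v).card = g) (c : ZMod g) :
    ∃ y, t ≤ y ∧ y ≤ L ∧ w y = v ∧ (y : ZMod g) = c := by
  have himg : (visits w (Finset.Icc t L) v).image (fun i : ℕ => (i : ZMod g)) = Finset.univ := by
    apply Finset.eq_univ_of_card
    rw [Finset.card_image_of_injOn (h.injOn_right ht htZ v), hv, ZMod.card]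
  have hc := Finset.mem_univ c
  rw [← himg, Finset.mem_image] at hc
  obtain ⟨y, hy, rfl⟩ := hc
  rw [mem_visits, Finset.mem_Icc] at hy
  exact ⟨y, hy.1.1, hy.1.2, hy.2, rfl⟩

lemma Irreducible.card_add_card_le (h : Irreducible w g L Z) {t : ℕ} (ht : t ≤ L)
    (htZ : w t ∈ Z) (v : α) :
    (visits w (Finset.range t) v).card + (visits w (Finset.Icc t L) v).card ≤ g + 1 := by
  have hl := h.injOn_left ht htZ v
  have hr := h.injOn_right ht htZ v
  rcases Finset.eq_empty_or_nonempty (visits w (Finset.range t) v) with h0 | h0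
  · have := h.card_right_le ht htZ v
    simp only [h0, Finset.card_empty]
    omega
  rcases Finset.eq_empty_or_nonempty (visits w (Finset.Icc t L) v) with h1 | h1
  · have := card_le_of_injOn_cast hl
    simp only [h1, Finset.card_empty]
    omega
  obtain ⟨x, hx, hxmax⟩ := Finset.exists_max_image _ id h0
  obtain ⟨x', hx', hxmin⟩ := Finset.exists_min_image _ id h1
  simp only [id] at hxmax hxmin
  have hx2 := mem_visits.1 hx
  have hx2' := mem_visits.1 hx'
  simp only [Finset.mem_range, Finset.mem_Icc] at hx2 hx2'
  have hdisj : Disjoint (visits w (Finset.range t) v) ((visits w (Finset.Icc t L) v).erase x') := by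
    rw [Finset.disjoint_left]
    intro i hi hi'
    have := mem_visits.1 hi
    have := mem_visits.1 (Finset.mem_of_mem_erase hi')
    simp only [Finset.mem_range, Finset.mem_Icc] at *
    omega
  have key : Set.InjOn (fun i : ℕ => if i < t then (i : ZMod g) - x else (i : ZMod g) - x')
      ((visits w (Finset.range t) v ∪ (visits w (Finset.Icc t L) v).erase x' : Finset ℕ) :
        Set ℕ) := by
    have cross : ∀ i ∈ visits w (Finset.range t) v, ∀ j ∈ (visits w (Finset.Icc t L) v).erase x',
        (i : ZMod g) - x ≠ (j : ZMod g) - x' := by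
      intro i hi j hj hij
      have h1 := hxmax i hi
      have hj' := Finset.mem_of_mem_erase hj
      have h2 := hxmin j hj'
      have h3 := Finset.ne_of_mem_erase hj
      have hi2 := mem_visits.1 hi
      have hj2 := mem_visits.1 hj'
      simp only [Finset.mem_range, Finset.mem_Icc] at hi2 hj2
      exact h i x x' j t h1 (by omega) h2 hj2.1.2 (hi2.2.trans hx2.2.symm)
        (hx2'.2.trans hj2.2.symm) (Or.inr (by omega)) (by linear_combination -hij) htZ (by omega)
    have ltt : ∀ i ∈ visits w (Finset.range t) v, i < t := fun i hi => by
      have := mem_visits.1 hi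
      simpa using this.1
    have get : ∀ i ∈ (visits w (Finset.Icc t L) v).erase x', ¬ i < t := fun i hi => by
      have := mem_visits.1 (Finset.mem_of_mem_erase hi)
      simp only [Finset.mem_Icc] at this
      omega
    intro i hi j hj hij
    simp only [Finset.coe_union, Set.mem_union, Finset.mem_coe] at hi hj
    rcases hi with hi | hi <;> rcases hj with hj | hj
    · simp only [if_pos (ltt i hi), if_pos (ltt j hj)] at hij
      exact hl hi hj (sub_left_injective hij)
    · simp only [if_pos (ltt i hi), if_neg (get j hj)] at hij
      exact (cross i hi j hj hij).elim
    · simp only [if_neg (get i hi), if_pos (ltt j hj)] at hij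
      exact (cross j hj i hi hij.symm).elim
    · simp only [if_neg (get i hi), if_neg (get j hj)] at hij
      exact hr (Finset.mem_of_mem_erase hi) (Finset.mem_of_mem_erase hj) (sub_left_injective hij)
  have := card_le_of_injOn_cast key
  rw [Finset.card_union_of_disjoint hdisj, Finset.card_erase_of_mem hx'] at this
  omega

/-- If an irreducible sequence has maximal length and first visits `Z` at time `t`, then before `t`
each node outside `Z` is visited once, and from `t` on each node is visited `g` times. -/
lemma Irreducible.visits_of_maximal [Fintype α] (h : Irreducible w g L Z) (hZ : Z.card = g)
    (hL : L + 1 + g = g * Fintype.card α + Fintype.card α) {t : ℕ} (ht : t ≤ L) (htZ : w t ∈ Z)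
    (hfirst : ∀ i < t, w i ∉ Z) :
    (∀ v, (visits w (Finset.Icc t L) v).card = g) ∧
      ∀ v, v ∉ Z → (visits w (Finset.range t) v).card = 1 := by
  set a : α → ℕ := fun v => (visits w (Finset.range t) v).card with ha
  set b : α → ℕ := fun v => (visits w (Finset.Icc t L) v).card with hb
  have haZ : ∀ v ∈ Z, a v = 0 := fun v hv => by
    simp only [ha, Finset.card_eq_zero, Finset.eq_empty_iff_forall_notMem, mem_visits,
      Finset.mem_range]
    rintro i ⟨hi, rfl⟩
    exact hfirst i hi hv
  have hsum : ∑ v, (a v + b v) = L + 1 := by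
    have h1 := Finset.card_eq_sum_card_fiberwise (f := w) (s := Finset.range t)
      (t := Finset.univ) (by intro _ _; simp)
    have h2 := Finset.card_eq_sum_card_fiberwise (f := w) (s := Finset.Icc t L)
      (t := Finset.univ) (by intro _ _; simp)
    rw [Finset.sum_add_distrib]
    simp only [Finset.card_range, Nat.card_Icc] at h1 h2
    have e1 : ∑ v, a v = t := h1.symm
    have e2 : ∑ v, b v = L + 1 - t := h2.symm
    omega
  have hle : ∀ v ∈ Finset.univ, a v + b v ≤ if v ∈ Z then g else g + 1 := by
    intro v _
    split_ifs with hv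
    · rw [haZ v hv, zero_add]
      exact h.card_right_le ht htZ v
    · exact h.card_add_card_le ht htZ v
  have hbound : ∑ v, (if v ∈ Z then g else g + 1) = L + 1 := by
    have : ∑ v, ((if v ∈ Z then g else g + 1) + if v ∈ Z then 1 else 0) = ∑ _v : α, (g + 1) :=
      Finset.sum_congr rfl fun v _ => by split_ifs <;> rfl
    rw [Finset.sum_add_distrib] at this
    simp only [Finset.sum_boole, Finset.filter_univ_mem, hZ, Finset.sum_const, Finset.card_univ,
      smul_eq_mul, Nat.cast_id] at this
    linarith
  have heq := (Finset.sum_eq_sum_iff_of_le hle).1 (hsum.trans hbound.symm)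
  have hbZ : ∀ v ∈ Z, b v = g := fun v hv => by
    have := heq v (Finset.mem_univ v)
    rwa [if_pos hv, haZ v hv, zero_add] at this
  have ha1 : ∀ v, a v ≤ 1 := by
    intro v
    by_contra! hlt
    obtain ⟨i, hi, j, hj, hij⟩ := Finset.one_lt_card.1 hlt
    wlog hlt' : i < j generalizing i j
    · exact this j hj i hi hij.symm (by omega)
    obtain ⟨y, hty, hyL, hyw, hyc⟩ := h.exists_visit ht htZ (hbZ _ htZ) (t - (j - i : ZMod g))
    rw [mem_visits, Finset.mem_range] at hi hj
    exact h i j t y t hlt'.le (by omega) hty hyL (hi.2.trans hj.2.symm) hyw.symm (Or.inl hlt')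
      (by rw [hyc]; ring) htZ (by omega)
  have hout : ∀ v, v ∉ Z → a v = 1 ∧ b v = g := fun v hv => by
    have h1 := heq v (Finset.mem_univ v)
    rw [if_neg hv] at h1
    have h2 := ha1 v
    have h3 : b v ≤ g := h.card_right_le ht htZ v
    omega
  exact ⟨fun v => if hv : v ∈ Z then hbZ v hv else (hout v hv).2, fun v hv => (hout v hv).1⟩

/-- The shape of the beginning of an irreducible sequence of maximal length, when `Z` is
enumerated cyclically by `z` and stretches between visits to `Z` are as short as along `z`. -/
theorem Irreducible.exists_decomposition [Fintype α] (h : Irreducible w g L Z) (hg : 2 ≤ g)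
    (hZ : Z.card = g) (hL : L + 1 + g = g * Fintype.card α + Fintype.card α) {z : ℕ → α}
    (hz : ∀ v, v ∈ Z ↔ ∃ k, z k = v)
    (hzinj : ∀ k i j, i < g → j < g → z (k + i) = z (k + j) → i = j)
    (hshort : ∀ s s' k d, s ≤ s' → s' ≤ L → w s = z k → w s' = z (k + d) → d < g →
      (s' : ZMod g) = s + d → s' = s + d)
    (hvisit : ∃ t ≤ L, w t ∈ Z) :
    ∃ t t', t + g ≤ t' ∧ t' ≤ L ∧ w t' ∈ Z ∧
      (∀ i < t, w i ∉ Z) ∧ (∀ v, v ∉ Z → (visits w (Finset.Ico 0 t) v).card = 1) ∧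
      (∀ i, t ≤ i → i < t + g → w i ∈ Z) ∧
      (∀ v ∈ Z, (visits w (Finset.Ico t (t + g)) v).card = 1) ∧
      (∀ i, t + g ≤ i → i < t' → w i ∉ Z) ∧
      (∀ v, v ∉ Z → (visits w (Finset.Ico (t + g) t') v).card = 1) := by
  obtain ⟨t, ⟨ht, htZ⟩, hmin⟩ : ∃ t, (t ≤ L ∧ w t ∈ Z) ∧ ∀ i < t, ¬ (i ≤ L ∧ w i ∈ Z) :=
    ⟨Nat.find hvisit, Nat.find_spec hvisit, fun i hi => Nat.find_min hvisit hi⟩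
  have hfirst : ∀ i < t, w i ∉ Z := fun i hi hiZ => hmin i hi ⟨by omega, hiZ⟩
  obtain ⟨hright, hleft⟩ := h.visits_of_maximal hZ hL ht htZ hfirst
  have hex := fun v => h.exists_visit ht htZ (hright v)
  obtain ⟨k, hk⟩ := (hz _).1 htZ
  have hblock : ∀ d < g, w (t + d) = z (k + d) ∧ t + d ≤ L := fun d hd => by
    obtain ⟨y, hty, hyL, hyw, hyc⟩ := hex (z (k + d)) (t + d)
    have := hshort t y k d hty hyL hk.symm hyw hd hyc
    subst this
    exact ⟨hyw, hyL⟩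
  have hblockZ : ∀ i, t ≤ i → i < t + g → w i ∈ Z := fun i hi hi' => by
    obtain ⟨d, rfl⟩ := Nat.exists_eq_add_of_le hi
    rw [(hblock d (by omega)).1]
    exact (hz _).2 ⟨_, rfl⟩
  have hblockinj : ∀ i j, t ≤ i → i < t + g → t ≤ j → j < t + g → w i = w j → i = j := by
    intro i j hi hi' hj hj' hij
    obtain ⟨d, rfl⟩ := Nat.exists_eq_add_of_le hi
    obtain ⟨e, rfl⟩ := Nat.exists_eq_add_of_le hj
    rw [(hblock d (by omega)).1, (hblock e (by omega)).1] at hij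
    rw [hzinj k d e (by omega) (by omega) hij]
  have hblocksurj : ∀ v ∈ Z, ∃ i, t ≤ i ∧ i < t + g ∧ w i = v := by
    have himg : (Finset.Ico t (t + g)).image w = Z := by
      apply Finset.eq_of_subset_of_card_le
      · intro v hv
        obtain ⟨i, hi, rfl⟩ := Finset.mem_image.1 hv
        rw [Finset.mem_Ico] at hi
        exact hblockZ i hi.1 hi.2
      · rw [Finset.card_image_of_injOn, hZ, Nat.card_Ico]
        · omega
        · intro i hi j hj
          simp only [Finset.coe_Ico, Set.mem_Ico] at hi hj
          exact hblockinj i j hi.1 hi.2 hj.1 hj.2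
    intro v hv
    rw [← himg, Finset.mem_image] at hv
    obtain ⟨i, hi, rfl⟩ := hv
    rw [Finset.mem_Ico] at hi
    exact ⟨i, hi.1, hi.2, rfl⟩
  have hnext : ∃ y, t + g ≤ y ∧ y ≤ L ∧ w y ∈ Z := by
    obtain ⟨y, hty, hyL, hyw, hyc⟩ := hex (w t) (t + 1)
    refine ⟨y, ?_, hyL, hyw ▸ htZ⟩
    by_contra! hlt
    have hyt := hblockinj y t hty hlt le_rfl (by omega) hyw
    rw [hyt] at hyc
    have : Fact (1 < g) := ⟨by omega⟩
    exact one_ne_zero (α := ZMod g) (by linear_combination -hyc)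
  obtain ⟨t', ⟨htt', ht'L, ht'Z⟩, hmin'⟩ : ∃ t', (t + g ≤ t' ∧ t' ≤ L ∧ w t' ∈ Z) ∧
      ∀ i < t', ¬ (t + g ≤ i ∧ i ≤ L ∧ w i ∈ Z) :=
    ⟨Nat.find hnext, Nat.find_spec hnext, fun i hi => Nat.find_min hnext hi⟩
  have hgap : ∀ i, t + g ≤ i → i < t' → w i ∉ Z := fun i hi hi' hiZ =>
    hmin' i hi' ⟨hi, by omega, hiZ⟩
  obtain ⟨r, htr, hrg, hrw⟩ := hblocksurj _ ht'Z
  refine ⟨t, t', htt', ht'L, ht'Z, hfirst, ?_, hblockZ, ?_, hgap, ?_⟩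
  · simpa [← Finset.range_eq_Ico] using hleft
  · intro v hv
    obtain ⟨i, hi, hi', rfl⟩ := hblocksurj v hv
    rw [Finset.card_eq_one]
    refine ⟨i, Finset.eq_singleton_iff_unique_mem.2 ⟨by simp [mem_visits, hi, hi'], ?_⟩⟩
    intro j hj
    rw [mem_visits, Finset.mem_Ico] at hj
    exact hblockinj j i hj.1.1 hj.1.2 hi hi' hj.2
  · intro v hv
    obtain ⟨x, hx⟩ := Finset.card_eq_one.1 (hleft v hv)
    have hx0 : x ∈ visits w (Finset.range t) v := by rw [hx]; exact Finset.mem_singleton_self x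
    rw [mem_visits, Finset.mem_range] at hx0
    have hresidue : ∀ i, t + g ≤ i → i < t' → w i = v → (i : ZMod g) = x + (t' - r) := by
      intro i hi hi' hiv
      obtain ⟨y, hty, hyL, hyw, hyc⟩ := hex (w t') (t' - (i - x : ZMod g))
      rcases lt_or_ge y (t + g) with hy | hy
      · have := hblockinj y r hty hy htr hrg (hyw.trans hrw.symm)
        subst this
        linear_combination hyc
      · have hyt : t' ≤ y := by
          by_contra! hlt
          exact hgap y hy hlt (hyw ▸ ht'Z)
        exact (h x i t' y t' (by omega) hi'.le hyt hyL (hx0.2.trans hiv.symm) hyw.symm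
          (Or.inl (by omega)) (by rw [hyc]; ring) ht'Z (Or.inr (Or.inl ⟨hi'.le, le_rfl⟩))).elim
    have hvT : ∀ i, t ≤ i → w i = v → t + g ≤ i := fun i hi hiv => by
      by_contra! hlt
      exact hv (hiv ▸ hblockZ i hi hlt)
    rw [Finset.card_eq_one]
    have hexists : ∃ i, t + g ≤ i ∧ i < t' ∧ w i = v := by
      by_contra! hnone
      have hlate : ∀ i, t ≤ i → w i = v → t' ≤ i := fun i hi hiv => by
        by_contra! hlt
        exact hnone i (hvT i hi hiv) hlt hiv
      have hne : (visits w (Finset.Icc t L) v).Nonempty := by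
        rw [← Finset.card_pos, hright]
        omega
      obtain ⟨x₁, hx₁, hx₁min⟩ := Finset.exists_min_image _ id hne
      simp only [id] at hx₁min
      rw [mem_visits, Finset.mem_Icc] at hx₁
      obtain ⟨y, hty, hyL, hyw, hyc⟩ := hex v (x₁ - (t' - r : ZMod g))
      exact h r t' x₁ y r (by omega) (hlate x₁ hx₁.1.1 hx₁.2)
        (hx₁min y (by simp [mem_visits, hty, hyL, hyw])) hyL hrw (hx₁.2.trans hyw.symm)
        (Or.inl (by omega)) (by rw [hyc]; ring) (hrw ▸ ht'Z) (Or.inl le_rfl)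
    obtain ⟨i, hi, hi', hiv⟩ := hexists
    refine ⟨i, Finset.eq_singleton_iff_unique_mem.2 ⟨by simp [mem_visits, hi, hi', hiv], ?_⟩⟩
    intro j hj
    rw [mem_visits, Finset.mem_Ico] at hj
    refine h.injOn_right ht htZ v ?_ ?_
      ((hresidue j hj.1.1 hj.1.2 hj.2).trans (hresidue i hi hi' hiv).symm)
    · simp only [Finset.mem_coe, mem_visits, Finset.mem_Icc]
      exact ⟨by omega, hj.2⟩
    · simp only [Finset.mem_coe, mem_visits, Finset.mem_Icc]
      exact ⟨by omega, hiv⟩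

end Irreducible

lemma weight_cons_cons (A : Mat n) (x y : Fin n) (l : List (Fin n)) :
    weight A (x :: y :: l) = A x y + weight A (y :: l) := by
  simp [weight]

@[simp]
lemma weight_singleton (A : Mat n) (x : Fin n) : weight A [x] = 0 := by
  simp [weight]

lemma weight_append_tail (A : Mat n) {U U' : List (Fin n)} {y : Fin n}
    (hU : U.getLast? = some y) (hU' : U'.head? = some y) :
    weight A (U ++ U'.tail) = weight A U + weight A U' := by
  obtain ⟨l, rfl⟩ : ∃ l, U' = y :: l := List.head?_eq_some_iff.1 hU'
  induction U with
  | nil => simp at hU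
  | cons x U ih =>
    cases U with
    | nil =>
      obtain rfl : x = y := by simpa using hU
      simp
    | cons x' U =>
      rw [List.getLast?_cons_cons] at hU
      simp only [List.tail_cons, List.cons_append, weight_cons_cons] at ih ⊢
      rw [ih hU, add_assoc]

section IsWalkFrom

variable {R : Fin n → Fin n → Prop} {U U' : List (Fin n)} {x y v : Fin n}

lemma IsWalkFrom.singleton (R : Fin n → Fin n → Prop) (x : Fin n) : IsWalkFrom R [x] x x := by
  refine ⟨⟨by simp, List.isChain_singleton x⟩, rfl, rfl⟩

lemma IsWalkFrom.cons (h : IsWalkFrom R U y v) (hxy : R x y) : IsWalkFrom R (x :: U) x v := by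
  obtain ⟨⟨-, hc⟩, hh, hl⟩ := h
  obtain ⟨l, rfl⟩ := List.head?_eq_some_iff.1 hh
  exact ⟨⟨by simp, List.isChain_cons_cons.2 ⟨hxy, hc⟩⟩, rfl, by rwa [List.getLast?_cons_cons]⟩

lemma IsWalkFrom.length_pos (h : IsWalkFrom R U x y) : 0 < U.length :=
  List.length_pos_of_ne_nil h.1.1

lemma IsWalkFrom.append (h : IsWalkFrom R U x y) (h' : IsWalkFrom R U' y v) :
    IsWalkFrom R (U ++ U'.tail) x v := by
  obtain ⟨⟨hne, hc⟩, hh, hl⟩ := h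
  obtain ⟨⟨-, hc'⟩, hh', hl'⟩ := h'
  obtain ⟨l, rfl⟩ := List.head?_eq_some_iff.1 hh'
  refine ⟨⟨by simp [hne], ?_⟩, by simp [List.head?_append, hh], ?_⟩
  · rw [List.tail_cons]
    refine List.isChain_append.2 ⟨hc, (List.isChain_cons.1 hc').2, ?_⟩
    rw [hl]
    intro a ha b hb
    obtain rfl : y = a := by simpa using ha
    exact (List.isChain_cons.1 hc').1 b hb
  · rw [List.tail_cons, List.getLast?_append, hl]
    cases l with
    | nil => simpa using hl'
    | cons b l =>
      rw [List.getLast?_cons_cons] at hl'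
      rw [hl', Option.some_or]

lemma IsWalkFrom.len_append (h : IsWalkFrom R U x y) (h' : IsWalkFrom R U' y v) :
    len (U ++ U'.tail) = len U + len U' := by
  have := h.length_pos
  have := h'.length_pos
  simp only [len, List.length_append, List.length_tail]
  omega

lemma IsWalkFrom.weight_append (A : Mat n) (h : IsWalkFrom R U x y) (h' : IsWalkFrom R U' y v) :
    weight A (U ++ U'.tail) = weight A U + weight A U' :=
  weight_append_tail A h.2.2 h'.2.1

lemma IsWalkFrom.take (h : IsWalkFrom R U x y) {i : ℕ} (hi : U[i]? = some v) :
    IsWalkFrom R (U.take (i + 1)) x v := by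
  obtain ⟨⟨hne, hc⟩, hh, hl⟩ := h
  refine ⟨⟨by simp [hne], List.IsChain.take hc _⟩, by simp [List.head?_take, hh], ?_⟩
  simp [List.getLast?_take, hi]

lemma IsWalkFrom.drop (h : IsWalkFrom R U x y) {i : ℕ} (hi : U[i]? = some v) :
    IsWalkFrom R (U.drop i) v y := by
  obtain ⟨⟨hne, hc⟩, hh, hl⟩ := h
  have hlt := (List.getElem?_eq_some_iff.1 hi).1
  refine ⟨⟨by simp [hlt], List.IsChain.drop hc _⟩, by simp [List.head?_drop, hi], ?_⟩
  simp [List.getLast?_drop, hlt, hl]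

lemma IsWalkFrom.weight_split (A : Mat n) (h : IsWalkFrom R U x y) {i : ℕ}
    (hi : U[i]? = some v) : weight A U = weight A (U.take (i + 1)) + weight A (U.drop i) := by
  rw [← (h.take hi).weight_append A (h.drop hi), List.tail_drop, List.take_append_drop]

lemma IsWalkFrom.mem_append (h : IsWalkFrom R U x y) (h' : IsWalkFrom R U' y v) {c : Fin n}
    (hc : c ∈ U ∨ c ∈ U') : c ∈ U ++ U'.tail := by
  obtain ⟨l, rfl⟩ := List.head?_eq_some_iff.1 h'.2.1
  have := List.mem_of_getLast? h.2.2
  simp only [List.mem_cons, List.tail_cons, List.mem_append] at hc ⊢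
  rcases hc with hc | rfl | hc <;> tauto

lemma len_take_succ {i : ℕ} (hi : i < U.length) : len (U.take (i + 1)) = i := by
  simp only [len, List.length_take]
  omega

lemma len_drop (i : ℕ) : len (U.drop i) = len U - i := by
  simp only [len, List.length_drop]
  omega

end IsWalkFrom

lemma bddAbove_means (A : Mat n) : BddAbove {m | ∃ W, IsCycle (arc A) W ∧ m = mean A W} := by
  have hfin : {W : List (Fin n) | IsCycle (arc A) W}.Finite := by
    refine (List.finite_length_le (Fin n) (n + 1)).subset ?_
    rintro W ⟨-, -, -, hnd⟩
    have := hnd.length_le_card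
    simp only [List.length_dropLast, Fintype.card_fin] at this
    simp only [Set.mem_ofPred_eq]
    omega
  refine ((hfin.image (mean A)).subset ?_).bddAbove
  rintro _ ⟨W, hW, rfl⟩
  exact ⟨W, hW, rfl⟩

lemma weight_le_zero_of_mean {A : Mat n} {W : List (Fin n)} (hlen : 0 < len W)
    (h : mean A W ≤ 0) : weight A W ≤ 0 := by
  unfold mean at h
  cases hw : weight A W using WithBot.recBotCoe with
  | bot => exact bot_le
  | coe r =>
    rw [hw, WithBot.map_coe, ← WithBot.coe_zero, WithBot.coe_le_coe] at h
    rw [← WithBot.coe_zero, WithBot.coe_le_coe]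
    have hpos : (0 : ℝ) < len W := by exact_mod_cast hlen
    by_contra! hr
    exact absurd h (not_le.2 (div_pos hr hpos))

lemma weight_eq_zero_of_mean {A : Mat n} {W : List (Fin n)} (hlen : 0 < len W)
    (h : mean A W = 0) : weight A W = 0 := by
  unfold mean at h
  cases hw : weight A W using WithBot.recBotCoe with
  | bot => simp [hw] at h
  | coe r =>
    rw [hw, WithBot.map_coe, ← WithBot.coe_zero, WithBot.coe_inj] at h
    rw [← WithBot.coe_zero, WithBot.coe_inj]
    have hpos : (len W : ℝ) ≠ 0 := by exact_mod_cast hlen.ne'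
    simpa [hpos] using h

lemma IsCycle.weight_le_zero {A : Mat n} (hlam : lam A = 0) {W : List (Fin n)}
    (hW : IsCycle (arc A) W) : weight A W ≤ 0 := by
  refine weight_le_zero_of_mean (by have := hW.1; unfold len; omega) ?_
  rw [← hlam]
  exact le_csSup (bddAbove_means A) ⟨W, hW, rfl⟩

/-- When `λ(A) = 0`, closed walks have nonpositive weight. -/
lemma IsWalkFrom.weight_le_zero {A : Mat n} (hlam : lam A = 0) {W : List (Fin n)} {x : Fin n}
    (hW : IsWalkFrom (arc A) W x x) : weight A W ≤ 0 := by
  induction hm : W.length using Nat.strong_induction_on generalizing W x with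
  | _ m ih =>
    have hpos := hW.length_pos
    rcases Nat.lt_or_ge W.length 2 with hlt | hge
    · obtain ⟨y, rfl⟩ := List.length_eq_one_iff.1 (by omega : W.length = 1)
      simp
    by_cases hnd : W.dropLast.Nodup
    · exact IsCycle.weight_le_zero hlam ⟨hge, hW.1.2, hW.2.1.trans hW.2.2.symm, hnd⟩
    rw [List.nodup_iff_getElem?_ne_getElem?] at hnd
    push Not at hnd
    obtain ⟨i, j, hij, hj, heq⟩ := hnd
    rw [List.length_dropLast] at hj
    have hdrop : ∀ k, k < W.length - 1 → W.dropLast[k]? = W[k]? := fun k hk => by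
      rw [List.getElem?_dropLast, if_pos hk]
    rw [hdrop i (by omega), hdrop j hj] at heq
    obtain ⟨v, hv⟩ : ∃ v, W[j]? = some v := ⟨_, List.getElem?_eq_getElem (by omega)⟩
    rw [hv] at heq
    have hv' : (W.take (j + 1))[i]? = some v := by
      rw [List.getElem?_take_of_lt (by omega), heq]
    have h1 := hW.take hv
    have h2 := hW.drop hv
    have h3 := h1.take hv'
    have h4 := h1.drop hv'
    have hclosed := ih _ (by simp only [List.length_drop, List.length_take]; omega) h4 rfl
    have houter := ih _ (by
      simp only [List.length_append, List.length_tail, List.length_drop, List.length_take]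
      omega) (h3.append h2) rfl
    rw [h3.weight_append A h2] at houter
    calc weight A W = (weight A ((W.take (j + 1)).take (i + 1)) +
            weight A ((W.take (j + 1)).drop i)) + weight A (W.drop j) := by
          rw [hW.weight_split A hv, h1.weight_split A hv']
      _ = weight A ((W.take (j + 1)).drop i) + (weight A ((W.take (j + 1)).take (i + 1)) +
            weight A (W.drop j)) := by
          rw [add_comm (weight A ((W.take (j + 1)).take (i + 1))), add_assoc]
      _ ≤ 0 := add_nonpos hclosed houter

/-- A twice optimal walk cannot be replaced by a shorter walk of at least the same weight. -/
lemma TwiceOpt.len_le {A : Mat n} {Z0 : List (Fin n)} {i j : Fin n} {γ m : ℕ}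
    {W V : List (Fin n)} (h : TwiceOpt A Z0 i j γ m W) (hV : IsWalkFrom (arc A) V i j)
    (hZ : ∃ v ∈ V, v ∈ Z0) (hlen : len V ≡ len W [MOD γ]) (hw : weight A W ≤ weight A V) :
    len W ≤ len V := by
  have hmem : V ∈ ThroughSet A Z0 i j γ m := ⟨hV, hZ, hlen.trans h.1.2.2⟩
  exact h.2.2 V hmem (le_antisymm (h.2.1 V hmem) hw)

/-- Cutting two disjoint closed stretches out of a twice optimal walk. -/
lemma TwiceOpt.irreducible {A : Mat n} (hlam : lam A = 0) {Z0 : List (Fin n)} {a b : Fin n}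
    {γ m : ℕ} {W : List (Fin n)} (h : TwiceOpt A Z0 a b γ m W) {w : ℕ → Fin n}
    (hw : ∀ i, i < W.length → W[i]? = some (w i)) :
    Irreducible w γ (len W) Z0.toFinset := by
  intro s s' u u' y hss' hs'u huu' hu'L hws hwu hpos hmod hyZ hy
  have hW := h.1.1
  have hlen := hW.length_pos
  have hL : len W = W.length - 1 := rfl
  have hus : (W.drop s')[u - s']? = some (w u) := by
    rw [List.getElem?_drop, Nat.add_sub_cancel' hs'u, hw _ (by omega)]
  have hss : (W.take (s' + 1))[s]? = some (w s) := by
    rw [List.getElem?_take_of_lt (by omega), hw _ (by omega)]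
  have huus : ((W.drop s').drop (u - s'))[u' - u]? = some (w u') := by
    rw [List.getElem?_drop, List.getElem?_drop,
      show s' + (u - s' + (u' - u)) = u' by omega, hw _ (by omega)]
  have hl := hW.take (hw s' (by omega))
  have hr := hW.drop (hw s' (by omega))
  have h1 := hl.take hss
  have h2 := hl.drop hss
  have h3 := hr.take hus
  have h45 := hr.drop hus
  have h4 := h45.take huus
  have h5 := h45.drop huus
  rw [← hws] at h2 h3
  rw [← hwu] at h4 h5
  have hweight : weight A W = (weight A ((W.take (s' + 1)).take (s + 1)) +
      weight A ((W.take (s' + 1)).drop s)) + (weight A ((W.drop s').take (u - s' + 1)) +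
      (weight A (((W.drop s').drop (u - s')).take (u' - u + 1)) +
      weight A (((W.drop s').drop (u - s')).drop (u' - u)))) := by
    rw [hW.weight_split A (hw s' (by omega)), hl.weight_split A hss, hr.weight_split A hus,
      h45.weight_split A huus]
  have h35 := h3.append h5
  have hlenV : len ((W.take (s' + 1)).take (s + 1) ++ ((W.drop s').take (u - s' + 1) ++
      (((W.drop s').drop (u - s')).drop (u' - u)).tail).tail) + ((s' - s) + (u' - u)) = len W := by
    rw [h1.len_append h35, h3.len_append h5,
      len_take_succ (by simp only [List.length_take]; omega),
      len_take_succ (by simp only [List.length_drop]; omega), len_drop, len_drop, len_drop]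
    omega
  have hle := h.len_le (h1.append h35) ⟨w y, ?_, by simpa using hyZ⟩ ?_ ?_
  · omega
  · have hWy : W[y]? = some (w y) := hw y (by omega)
    refine h1.mem_append h35 (hy.imp (fun hy => ?_) fun hy => h3.mem_append h5
      (hy.imp (fun hy => ?_) fun hy => ?_))
    · refine List.mem_of_getElem? (i := y) ?_
      rw [List.getElem?_take_of_lt (by omega), List.getElem?_take_of_lt (by omega), hWy]
    · refine List.mem_of_getElem? (i := y - s') ?_
      rw [List.getElem?_take_of_lt (by omega), List.getElem?_drop, Nat.add_sub_cancel' hy.1, hWy]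
    · refine List.mem_of_getElem? (i := y - u') ?_
      rw [List.getElem?_drop, List.getElem?_drop, List.getElem?_drop,
        show s' + (u - s' + (u' - u + (y - u'))) = y by omega, hWy]
  · rw [← hlenV, ← ZMod.natCast_eq_natCast_iff]
    push_cast [Nat.cast_sub hss', Nat.cast_sub huu']
    rw [hmod, add_zero]
  · rw [hweight, h1.weight_append A h35, h3.weight_append A h5]
    have hc2 := h2.weight_le_zero hlam
    have hc4 := h4.weight_le_zero hlam
    exact add_le_add (add_le_of_nonpos_right hc2)
      (add_le_add le_rfl (add_le_of_nonpos_left hc4))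

section Enumeration

variable {A : Mat n} {z : ℕ → Fin n}

lemma isWalkFrom_map_range' {R : Fin n → Fin n → Prop} (hz : ∀ k, R (z k) (z (k + 1)))
    (k d : ℕ) : IsWalkFrom R ((List.range' k (d + 1)).map z) (z k) (z (k + d)) := by
  induction d generalizing k with
  | zero => exact IsWalkFrom.singleton R _
  | succ d ih =>
    have := (ih (k + 1)).cons (hz k)
    rwa [← List.map_cons, ← List.range'_succ, add_assoc k, add_comm 1] at this

lemma weight_map_range' (k d : ℕ) : weight A ((List.range' k (d + 1)).map z) =
    ∑ i ∈ Finset.range d, A (z (k + i)) (z (k + i + 1)) := by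
  induction d generalizing k with
  | zero => simp
  | succ d ih =>
    rw [List.range'_succ, List.map_cons, List.range'_succ, List.map_cons, weight_cons_cons,
      ← List.map_cons, ← List.range'_succ, ih, Finset.sum_range_succ', add_comm]
    simp only [add_zero, add_assoc, add_comm 1]

lemma len_map_range' (k d : ℕ) : len ((List.range' k (d + 1)).map z) = d := by
  simp [len]

lemma sum_range_add_of_periodic {f : ℕ → Rmax} {g : ℕ} (hf : ∀ k, f (k + g) = f k)
    (hbot : ∀ k, f k ≠ ⊥) (k : ℕ) :
    ∑ i ∈ Finset.range g, f (k + i) = ∑ i ∈ Finset.range g, f i := by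
  induction k with
  | zero => simp
  | succ k ih =>
    rw [← ih, ← WithBot.add_right_inj (hbot k)]
    have h1 := Finset.sum_range_succ' (fun i => f (k + i)) g
    rw [Finset.sum_range_succ, hf] at h1
    rw [h1]
    simp only [add_zero, add_right_comm, add_assoc]

/-- In a twice optimal walk, a stretch between two nodes of a zero-weight cycle `z` is as short as
the arc of `z` joining them, if the two lengths are congruent. -/
lemma TwiceOpt.eq_add {W Z0 : List (Fin n)} {a b : Fin n} {g m : ℕ} (hlam : lam A = 0)
    (h : TwiceOpt A Z0 a b g m W) {w : ℕ → Fin n}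
    (hw : ∀ i, i < W.length → W[i]? = some (w i)) (hz : ∀ k, arc A (z k) (z (k + 1)))
    (hzg : ∀ k, z (k + g) = z k) (hzZ : ∀ k, z k ∈ Z0)
    (hz0 : ∑ i ∈ Finset.range g, A (z i) (z (i + 1)) = 0) {s s' k d : ℕ} (hss' : s ≤ s')
    (hs' : s' ≤ len W) (hs : w s = z k) (hsd : w s' = z (k + d)) (hd : d < g)
    (hmod : (s' : ZMod g) = s + d) : s' = s + d := by
  have hW := h.1.1
  have hlen := hW.length_pos
  have hL : len W = W.length - 1 := rfl
  have hmod' : s' ≡ s + d [MOD g] := by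
    rw [← ZMod.natCast_eq_natCast_iff]
    exact_mod_cast hmod
  have hss : (W.take (s' + 1))[s]? = some (w s) := by
    rw [List.getElem?_take_of_lt (by omega), hw _ (by omega)]
  have hl := hW.take (hw s' (by omega))
  have hr := hW.drop (hw s' (by omega))
  have h1 := hl.take hss
  have h2 := hl.drop hss
  rw [hsd] at hr h2
  rw [hs] at h1 h2
  have hZ1 := isWalkFrom_map_range' hz k d
  have hZ2 := isWalkFrom_map_range' hz (k + d) (g - d)
  rw [show k + d + (g - d) = k + g by omega, hzg] at hZ2
  have hZ0 : weight A ((List.range' k (d + 1)).map z) +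
      weight A ((List.range' (k + d) (g - d + 1)).map z) = 0 := by
    rw [weight_map_range', weight_map_range', ← hz0,
      ← sum_range_add_of_periodic (f := fun i => A (z i) (z (i + 1))) (g := g)
        (fun k => by rw [hzg, add_right_comm, hzg]) hz k]
    conv_rhs => rw [← Nat.add_sub_of_le hd.le, Finset.sum_range_add]
    simp only [add_assoc]
  have hM : weight A ((W.take (s' + 1)).drop s) ≤ weight A ((List.range' k (d + 1)).map z) := by
    have hc := (h2.append hZ2).weight_le_zero hlam
    rw [h2.weight_append A hZ2] at hc
    calc weight A ((W.take (s' + 1)).drop s)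
        = (weight A ((W.take (s' + 1)).drop s) +
          weight A ((List.range' (k + d) (g - d + 1)).map z)) +
          weight A ((List.range' k (d + 1)).map z) := by
          rw [add_assoc, add_comm (weight A ((List.range' (k + d) (g - d + 1)).map z)), hZ0,
            add_zero]
      _ ≤ weight A ((List.range' k (d + 1)).map z) := add_le_of_nonpos_left hc
  have hZr := hZ1.append hr
  have hlenV : len ((W.take (s' + 1)).take (s + 1) ++
      ((List.range' k (d + 1)).map z ++ (W.drop s').tail).tail) = s + (d + (len W - s')) := by
    rw [h1.len_append hZr, hZ1.len_append hr,
      len_take_succ (by simp only [List.length_take]; omega), len_map_range', len_drop]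
  have hle := h.len_le (h1.append hZr) ⟨z k, ?_, hzZ k⟩ ?_ ?_
  · have hle' : s' ≤ s + d := by omega
    refine Nat.ModEq.eq_of_abs_lt hmod' ?_
    rw [abs_lt]
    push_cast
    omega
  · exact h1.mem_append hZr (Or.inl (List.mem_of_getLast? h1.2.2))
  · rw [hlenV, ← add_assoc]
    calc s + d + (len W - s') ≡ s' + (len W - s') [MOD g] := (hmod'.symm).add_right _
      _ = len W := by omega
  · rw [h1.weight_append A hZr, hZ1.weight_append A hr, hW.weight_split A (hw s' (by omega)),
      hl.weight_split A hss, add_assoc]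
    exact add_le_add le_rfl (add_le_add hM le_rfl)

end Enumeration

/-- A cycle is enumerated by a periodic sequence of nodes. -/
lemma IsCycle.exists_enumeration {R : Fin n → Fin n → Prop} {Z0 : List (Fin n)} {g : ℕ}
    (h : IsCycle R Z0) (hlen : len Z0 = g) :
    ∃ z : ℕ → Fin n, Z0 = (List.range' 0 (g + 1)).map z ∧ (∀ k, z (k + g) = z k) ∧
      (∀ k, R (z k) (z (k + 1))) ∧ (∀ v, v ∈ Z0 ↔ ∃ k, z k = v) ∧
      (∀ k i j, i < g → j < g → z (k + i) = z (k + j) → i = j) ∧ Z0.toFinset.card = g := by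
  obtain ⟨h2, hc, hhl, hnd⟩ := h
  have hg : Z0.length = g + 1 := by unfold len at hlen; omega
  have hg0 : 0 < g := by omega
  have hmod : ∀ i, i % g < Z0.length := fun i => (Nat.mod_lt i hg0).trans (by omega)
  set z : ℕ → Fin n := fun i => Z0[i % g]'(hmod i) with hz
  have hzg : ∀ k, z (k + g) = z k := fun k => by simp [hz]
  have hzmod : ∀ k, z (k % g) = z k := fun k => by simp [hz]
  have hget : ∀ i (hi : i < Z0.length), Z0[i] = z i := by
    intro i hi
    rcases Nat.lt_or_ge i g with hlt | hge
    · simp only [hz, Nat.mod_eq_of_lt hlt]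
    · obtain rfl : i = g := by omega
      simp only [hz, Nat.mod_self]
      rw [List.head?_eq_getElem?, List.getLast?_eq_getElem?, List.getElem?_eq_getElem (by omega),
        List.getElem?_eq_getElem (by omega), Option.some_inj] at hhl
      rw [hhl]
      simp [hg]
  have hZ0 : Z0 = (List.range' 0 (g + 1)).map z := by
    refine List.ext_getElem (by simp [hg]) fun i hi _ => ?_
    simp [hget i hi]
  have hinj : ∀ i j, i < g → j < g → z i = z j → i = j := by
    intro i j hi hj hij
    rw [List.nodup_iff_injective_get] at hnd
    have hdl : Z0.dropLast.length = g := by simp [hg]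
    have := @hnd ⟨i, by omega⟩ ⟨j, by omega⟩ (by
      simp only [List.get_eq_getElem, List.getElem_dropLast]
      rw [hget, hget, hij])
    simpa using this
  have hmem : ∀ v, v ∈ Z0 ↔ ∃ k, z k = v := by
    intro v
    constructor
    · intro hv
      obtain ⟨i, hi, rfl⟩ := List.getElem_of_mem hv
      exact ⟨i, (hget i hi).symm⟩
    · rintro ⟨k, rfl⟩
      exact List.getElem_mem _
  refine ⟨z, hZ0, hzg, ?_, hmem, ?_, ?_⟩
  · intro k
    have := List.isChain_iff_getElem.1 hc (k % g) (by have := Nat.mod_lt k hg0; omega)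
    rw [hget, hget, hzmod] at this
    have e : z (k % g + 1) = z (k + 1) := by
      rw [← hzmod (k % g + 1), Nat.mod_add_mod, hzmod]
    rwa [e] at this
  · intro k i j hi hj hij
    rw [← hzmod (k + i), ← hzmod (k + j)] at hij
    have := hinj _ _ (Nat.mod_lt _ hg0) (Nat.mod_lt _ hg0) hij
    have h' : i ≡ j [MOD g] := Nat.ModEq.add_left_cancel' k this
    exact h'.eq_of_lt_of_lt hi hj
  · have : Z0.toFinset = (Finset.range g).image z := by
      ext v
      rw [List.mem_toFinset, hmem, Finset.mem_image]
      constructor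
      · rintro ⟨k, rfl⟩
        exact ⟨k % g, Finset.mem_range.2 (Nat.mod_lt _ hg0), hzmod k⟩
      · rintro ⟨k, -, rfl⟩
        exact ⟨k, rfl⟩
    rw [this, Finset.card_image_of_injOn, Finset.card_range]
    intro i hi j hj
    exact hinj i j (by simpa using hi) (by simpa using hj)

lemma drop_eq_take_append_drop (W : List (Fin n)) {p q : ℕ} (hpq : p ≤ q) :
    W.drop p = (W.drop p).take (q - p) ++ W.drop q := by
  conv_lhs => rw [← List.take_append_drop (q - p) (W.drop p), List.drop_drop,
    Nat.add_sub_cancel' hpq]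

lemma take_drop_eq_map {W : List (Fin n)} {w : ℕ → Fin n}
    (hw : ∀ i, i < W.length → W[i]? = some (w i)) {p q : ℕ} (hpq : p ≤ q) (hq : q ≤ W.length) :
    (W.drop p).take (q - p) = (List.range' p (q - p)).map w := by
  refine List.ext_getElem (by simp; omega) fun i hi _ => ?_
  simp only [List.length_take, List.length_drop] at hi
  have := hw (p + i) (by omega)
  rw [List.getElem?_eq_getElem (by omega), Option.some_inj] at this
  simp [this]

lemma mem_map_range'_sub {w : ℕ → Fin n} {p q : ℕ} {P : Fin n → Prop}
    (h : ∀ i, p ≤ i → i < q → P (w i)) : ∀ v ∈ (List.range' p (q - p)).map w, P v := by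
  intro v hv
  obtain ⟨i, hi, rfl⟩ := List.mem_map.1 hv
  rw [List.mem_range'_1] at hi
  exact h i hi.1 (by omega)

lemma count_map_range' [DecidableEq (Fin n)] (w : ℕ → Fin n) (p q : ℕ) (v : Fin n) :
    ((List.range' p (q - p)).map w).count v = (visits w (Finset.Ico p q) v).card := by
  rw [List.count, List.countP_map, List.countP_eq_length_filter,
    ← List.toFinset_card_of_nodup (List.nodup_range' ..|>.filter _)]
  congr 1
  ext i
  simp only [List.mem_toFinset, List.mem_filter, List.mem_range'_1, mem_visits, Finset.mem_Ico,
    Function.comp_apply, beq_iff_eq]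
  omega


/-- Lemma 4.15: any interesting walk `W₀` decomposes as `W₀ = P Q P₁ V`, where `P` and
`P₁` contain every node not in `Z₀` exactly once and only such nodes, `Q` contains every
node of `Z₀` exactly once and only such nodes, and `V` starts with a node of `Z₀`. -/
theorem interesting_walk_decomposition {n : ℕ} (A : Mat n) (g : ℕ)
    (hgdef : g = maxGirth (critArc A)) (hg : 2 ≤ g) (hlam : lam A = 0)
    (hT : T1 A = DM g n)
    (Z0 : List (Fin n)) (hZ0 : IsCritCycle A Z0) (hZ0len : len Z0 = g)
    (hSC : ∀ i j, critNode A i → critNode A j → reach (critArc A) i j)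
    (huniq : ∀ Z, IsCritCycle A Z → len Z = g → Z.dropLast ~r Z0.dropLast) :
    ∀ a b W0, Interesting A g Z0 a b W0 →
      ∃ P Q P1 V : List (Fin n),
        W0 = P ++ Q ++ P1 ++ V ∧
        (∀ v ∈ P, v ∉ Z0) ∧ (∀ v : Fin n, v ∉ Z0 → P.count v = 1) ∧
        (∀ v ∈ Q, v ∈ Z0) ∧ (∀ v ∈ Z0, Q.count v = 1) ∧
        (∀ v ∈ P1, v ∉ Z0) ∧ (∀ v : Fin n, v ∉ Z0 → P1.count v = 1) ∧
        (∃ v ∈ Z0, V.head? = some v) := by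
  intro a b W0 ⟨hopt, hlen⟩
  obtain ⟨z, hZ0eq, hzg, hzarc, hzmem, hzinj, hZcard⟩ := hZ0.1.exists_enumeration hZ0len
  have : NeZero g := ⟨by omega⟩
  have hgn : g ≤ n := by
    have := Finset.card_le_univ Z0.toFinset
    rwa [hZcard, Fintype.card_fin] at this
  have hz0 : ∑ i ∈ Finset.range g, A (z i) (z (i + 1)) = 0 := by
    have := weight_eq_zero_of_mean (by omega) (hZ0.2.trans hlam)
    rw [hZ0eq, weight_map_range'] at this
    simpa using this
  have hpos := hopt.1.1.length_pos
  set w : ℕ → Fin n := fun i => W0.getD i a with hw_def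
  have hw : ∀ i, i < W0.length → W0[i]? = some (w i) := fun i hi => by
    simp [hw_def, hi]
  have hL : len W0 = W0.length - 1 := rfl
  have hmax : len W0 + 1 + g = g * Fintype.card (Fin n) + Fintype.card (Fin n) := by
    obtain ⟨k, rfl⟩ := Nat.exists_eq_add_of_le (hg.trans hgn)
    rw [hlen, DM, Fintype.card_fin, Nat.add_sub_cancel_left, mul_add]
    omega
  have hvisit : ∃ t ≤ len W0, w t ∈ Z0.toFinset := by
    obtain ⟨v, hv, hvZ⟩ := hopt.1.2.1
    obtain ⟨i, hi⟩ := List.getElem?_of_mem hv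
    have hi' := (List.getElem?_eq_some_iff.1 hi).1
    rw [hw i hi', Option.some_inj] at hi
    exact ⟨i, by omega, by simpa [hi] using hvZ⟩
  obtain ⟨t, t', htt', ht'L, ht'Z, hP, hPc, hQ, hQc, hP1, hP1c⟩ :=
    (hopt.irreducible hlam hw).exists_decomposition hg hZcard hmax
      (by simpa using hzmem) hzinj (fun s s' k d => hopt.eq_add hlam hw hzarc hzg
        (fun k => (hzmem _).2 ⟨k, rfl⟩) hz0) hvisit
  simp only [List.mem_toFinset] at ht'Z hP hPc hQ hQc hP1 hP1c
  have e1 := take_drop_eq_map hw (Nat.zero_le t) (by omega)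
  have e2 := take_drop_eq_map hw (Nat.le_add_right t g) (by omega)
  have e3 := take_drop_eq_map hw htt' (by omega)
  refine ⟨(W0.drop 0).take (t - 0), (W0.drop t).take (t + g - t),
    (W0.drop (t + g)).take (t' - (t + g)), W0.drop t', ?_, ?_, ?_, ?_, ?_, ?_, ?_,
    w t', ht'Z, by rw [List.head?_drop, hw _ (by omega)]⟩
  · rw [List.append_assoc, List.append_assoc, ← drop_eq_take_append_drop W0 htt',
      ← drop_eq_take_append_drop W0 (Nat.le_add_right t g),
      ← drop_eq_take_append_drop W0 (Nat.zero_le t), List.drop_zero]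
  · rw [e1]
    exact mem_map_range'_sub fun i _ hi => hP i hi
  · intro v hv
    rw [e1, count_map_range', hPc v hv]
  · rw [e2]
    exact mem_map_range'_sub hQ
  · intro v hv
    rw [e2, count_map_range', hQc v hv]
  · rw [e3]
    exact mem_map_range'_sub hP1
  · intro v hv
    rw [e3, count_map_range', hP1c v hv]

end MaxPlus
end
end
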